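/- arXiv:2111.12533 — 2 statements merged into one kernel-verified Lean document; each statement's English description precedes it below -/
import Mathlib

section
/- For every integer d ≥ 3, if S is a d-dimensional simplex of unit volume and B is a d-dimensional ball of unit volume, then there exist real numbers c_S and c_B such that n^{-d} · EH^S_{d,d+1}(n) converges to c_S as n → ∞, n^{-d} · EH^B_{d,d+1}(n) converges to c_B as n → ∞, and c_S < c_B. -/
open MeasureTheory Filter

noncomputable section

abbrev Euc (d : ℕ) : Type := EuclideanSpace ℝ (Fin d)

/-- A convex body: compact convex set with nonempty interior. -/
def IsConvexBody {d : ℕ} (K : Set (Euc d)) : Prop :=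
  Convex ℝ K ∧ IsCompact K ∧ (interior K).Nonempty

/-- A set of points is in convex position if no point lies in the convex
hull of the others. -/
def InConvexPosition {d : ℕ} (P : Set (Euc d)) : Prop :=
  ∀ p ∈ P, p ∉ convexHull ℝ (P \ {p})

/-- `H` is a `k`-hole in `S`. -/
def IsHole {d : ℕ} (k : ℕ) (S H : Finset (Euc d)) : Prop :=
  H ⊆ S ∧ H.card = k ∧ InConvexPosition (H : Set (Euc d)) ∧
    ∀ p ∈ S, p ∉ interior (convexHull ℝ (H : Set (Euc d)))

open Classical in
/-- The number of `k`-holes in the point set given by `x`. -/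
noncomputable def holeCount (d k n : ℕ) (x : Fin n → Euc d) : ℕ :=
  ((Finset.image x Finset.univ).powerset.filter
    (fun H => IsHole k (Finset.image x Finset.univ) H)).card

/-- The uniform probability distribution on `K`. -/
noncomputable def unif {d : ℕ} (K : Set (Euc d)) : Measure (Euc d) :=
  (volume K)⁻¹ • volume.restrict K

/-- The expected number of `k`-holes among `n` points drawn uniformly and
independently at random from `K`. -/
noncomputable def EH (d k : ℕ) (K : Set (Euc d)) (n : ℕ) : ℝ :=
  ∫ x : Fin n → Euc d, (holeCount d k n x : ℝ) ∂(Measure.pi fun _ : Fin n => unif K)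

/-- The probability that, for `d+2` points chosen uniformly and independently
at random from `K`, one of the points lies in the convex hull of the others. -/
noncomputable def pSimplex (d : ℕ) (K : Set (Euc d)) : ℝ :=
  ((Measure.pi fun _ : Fin (d + 2) => unif K)
    {x : Fin (d + 2) → Euc d | ∃ i, x i ∈ convexHull ℝ (x '' {j | j ≠ i})}).toReal

/-- The maximum of `pSimplex d K` over all convex bodies `K ⊆ ℝ^d`. -/
noncomputable def pMax (d : ℕ) : ℝ :=
  sSup {p : ℝ | ∃ K : Set (Euc d), IsConvexBody K ∧ p = pSimplex d K}

end

open scoped ENNReal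

/-- A function on the line that is even and nonincreasing in the absolute value. -/
def SymmDecreasing (ψ : ℝ → ℝ≥0∞) : Prop := ∀ x y : ℝ, |x| ≤ |y| → ψ y ≤ ψ x

theorem SymmDecreasing.measurable {ψ : ℝ → ℝ≥0∞} (h : SymmDecreasing ψ) : Measurable ψ := by
  have h1 : Antitone fun x : ℝ => ψ (max x 0) := by
    intro x y hxy
    apply h
    rw [abs_of_nonneg (le_max_right _ _), abs_of_nonneg (le_max_right _ _)]
    exact max_le_max_right 0 hxy
  have h2 : ψ = (fun x : ℝ => ψ (max x 0)) ∘ fun x => |x| := by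
    funext x
    simp only [Function.comp]
    rw [max_eq_left (abs_nonneg x)]
    exact le_antisymm (h _ _ (by simp)) (h _ _ (by simp))
  rw [h2]
  exact h1.measurable.comp measurable_abs

theorem SymmDecreasing.setLIntegral_Icc_le {ψ : ℝ → ℝ≥0∞} (h : SymmDecreasing ψ) (r : ℝ)
    {a b : ℝ} (hab : |a| ≤ |b|) :
    ∫⁻ t in Set.Icc (b - r) (b + r), ψ t ≤ ∫⁻ t in Set.Icc (a - r) (a + r), ψ t := by
  have key : ∀ a b : ℝ, 0 ≤ a → a ≤ b →
      ∫⁻ t in Set.Icc (b - r) (b + r), ψ t ≤ ∫⁻ t in Set.Icc (a - r) (a + r), ψ t := by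
    intro a b ha hab
    set A := Set.Icc (a - r) (a + r) with hA
    set B := Set.Icc (b - r) (b + r) with hB
    have e1 := lintegral_inter_add_sdiff (μ := volume) ψ A (measurableSet_Icc : MeasurableSet B)
    have e2 := lintegral_inter_add_sdiff (μ := volume) ψ B (measurableSet_Icc : MeasurableSet A)
    rw [← e1, ← e2, Set.inter_comm A B]
    gcongr 1
    rw [← lintegral_indicator (measurableSet_Icc.diff measurableSet_Icc),
      ← lintegral_indicator (measurableSet_Icc.diff measurableSet_Icc),
      ← lintegral_sub_left_eq_self _ (a + b)]
    apply lintegral_mono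
    intro t
    change (B \ A).indicator ψ (a + b - t) ≤ (A \ B).indicator ψ t
    by_cases ht : a + b - t ∈ B \ A
    · have ht' : t ∈ A \ B := by
        simp only [hA, hB, Set.mem_sdiff, Set.mem_Icc, not_and_or, not_le] at ht ⊢
        refine ⟨⟨by linarith [ht.1.2], by linarith [ht.1.1]⟩, ?_⟩
        rcases ht.2 with h1 | h1
        · right; linarith
        · left; linarith
      rw [Set.indicator_of_mem ht, Set.indicator_of_mem ht']
      apply h
      simp only [hA, hB, Set.mem_sdiff, Set.mem_Icc, not_and_or, not_le] at ht'
      have : t ≤ (a + b) / 2 := by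
        rcases ht'.2 with h1 | h1 <;> linarith [ht'.1.1, ht'.1.2]
      rw [abs_le]
      constructor
      · have := le_abs_self (a + b - t); linarith
      · have := le_abs_self (a + b - t); linarith
    · rw [Set.indicator_of_notMem ht]; exact zero_le
  have even : ∀ a : ℝ, ∫⁻ t in Set.Icc (a - r) (a + r), ψ t =
      ∫⁻ t in Set.Icc (|a| - r) (|a| + r), ψ t := by
    intro a
    rcases abs_choice a with ha | ha
    · rw [ha]
    · rw [ha, ← lintegral_indicator measurableSet_Icc, ← lintegral_indicator measurableSet_Icc,
        ← lintegral_neg_eq_self]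
      congr 1
      funext t
      have : -t ∈ Set.Icc (a - r) (a + r) ↔ t ∈ Set.Icc (-a - r) (-a + r) := by
        simp only [Set.mem_Icc]; constructor <;> rintro ⟨h1, h2⟩ <;> constructor <;> linarith
      by_cases ht : t ∈ Set.Icc (-a - r) (-a + r)
      · rw [Set.indicator_of_mem ht, Set.indicator_of_mem (this.2 ht)]
        exact le_antisymm (h _ _ (by simp)) (h _ _ (by simp))
      · rw [Set.indicator_of_notMem ht, Set.indicator_of_notMem (fun h => ht (this.1 h))]
  rw [even a, even b]
  exact key _ _ (abs_nonneg a) hab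

theorem SymmDecreasing.average {ψ : ℝ → ℝ≥0∞} (h : SymmDecreasing ψ) (r w : ℝ) :
    SymmDecreasing fun c => ∫⁻ t in Set.Icc (-r) r, ψ (c + w * t) := by
  intro x y hxy
  rcases eq_or_ne w 0 with rfl | hw
  · simp only [zero_mul, add_zero]
    exact lintegral_mono fun _ => h _ _ hxy
  have hχ : SymmDecreasing fun t => ψ (w * t) := by
    intro x y hxy
    apply h
    rw [abs_mul, abs_mul]
    gcongr
  have e : ∀ c : ℝ, ∫⁻ t in Set.Icc (-r) r, ψ (c + w * t) =
      ∫⁻ t in Set.Icc (c / w - r) (c / w + r), ψ (w * t) := by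
    intro c
    rw [← lintegral_indicator measurableSet_Icc, ← lintegral_indicator measurableSet_Icc,
      ← lintegral_add_left_eq_self ((Set.Icc (c / w - r) (c / w + r)).indicator _) (c / w)]
    congr 1
    funext t
    have : t ∈ Set.Icc (-r) r ↔ c / w + t ∈ Set.Icc (c / w - r) (c / w + r) := by
      simp only [Set.mem_Icc]; constructor <;> rintro ⟨h1, h2⟩ <;> constructor <;> linarith
    by_cases ht : t ∈ Set.Icc (-r) r
    · rw [Set.indicator_of_mem ht, Set.indicator_of_mem (this.1 ht)]
      congr 1; field_simp
    · rw [Set.indicator_of_notMem ht, Set.indicator_of_notMem (fun h => ht (this.2 h))]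
  simp only [e]
  apply hχ.setLIntegral_Icc_le
  rw [abs_div, abs_div]
  gcongr

theorem symmDecreasing_box {ψ : ℝ → ℝ≥0∞} (h : SymmDecreasing ψ) {n : ℕ} (r w : Fin n → ℝ) :
    SymmDecreasing fun c =>
      ∫⁻ t in Set.univ.pi fun i => Set.Icc (-r i) (r i), ψ (c + ∑ i, w i * t i) := by
  induction n generalizing ψ with
  | zero =>
    intro x y hxy
    simp only [Finset.univ_eq_empty, Finset.sum_empty, add_zero]
    exact lintegral_mono fun _ => h _ _ hxy
  | succ n ih =>
    have step := ih (h.average (r 0) (w 0)) (fun i => r i.succ) (fun i => w i.succ)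
    convert step using 2 with c
    have hm : Measurable fun t : Fin (n + 1) → ℝ => ψ (c + ∑ i, w i * t i) :=
      h.measurable.comp (by fun_prop)
    have mp := (volume_preserving_piFinSuccAbove (fun _ : Fin (n + 1) => ℝ) 0).symm
    have hbox : MeasurableSet (Set.univ.pi fun i : Fin (n + 1) => Set.Icc (-r i) (r i)) :=
      MeasurableSet.univ_pi fun _ => measurableSet_Icc
    rw [← mp.setLIntegral_comp_preimage hbox hm]
    have hpre : (MeasurableEquiv.piFinSuccAbove (fun _ : Fin (n + 1) => ℝ) 0).symm ⁻¹'
        (Set.univ.pi fun i => Set.Icc (-r i) (r i)) =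
        Set.Icc (-r 0) (r 0) ×ˢ Set.univ.pi fun i : Fin n => Set.Icc (-r i.succ) (r i.succ) := by
      ext ⟨t, s⟩
      simp only [Set.mem_preimage, Set.mem_univ_pi, Set.mem_prod, Fin.forall_fin_succ]
      simp [MeasurableEquiv.piFinSuccAbove, Fin.consEquiv]
    rw [hpre, Measure.volume_eq_prod, ← Measure.prod_restrict, lintegral_prod_symm]
    · refine lintegral_congr fun s => lintegral_congr fun t => ?_
      congr 1
      simp [MeasurableEquiv.piFinSuccAbove, Fin.sum_univ_succ]
      ring
    · exact (hm.comp mp.measurable).aemeasurable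

/-- The volume of the part of a centered box on which a linear form lies in an interval of given
length is largest when the interval is centered. -/
theorem volume_box_slab_le {n : ℕ} (r w : Fin n → ℝ) (s : ℝ) (c c' : ℝ) (hc : |c'| ≤ |c|) :
    volume {t : Fin n → ℝ | (∀ i, t i ∈ Set.Icc (-r i) (r i)) ∧ |c + ∑ i, w i * t i| ≤ s} ≤
    volume {t : Fin n → ℝ | (∀ i, t i ∈ Set.Icc (-r i) (r i)) ∧ |c' + ∑ i, w i * t i| ≤ s} := by
  have h : SymmDecreasing (Set.indicator {x : ℝ | |x| ≤ s} 1) := by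
    intro x y hxy
    by_cases hy : |y| ≤ s
    · rw [Set.indicator_of_mem (show x ∈ {x : ℝ | |x| ≤ s} from hxy.trans hy)]
      exact Set.indicator_le_self' (by simp) _
    · rw [Set.indicator_of_notMem (show y ∉ {x : ℝ | |x| ≤ s} from hy)]; exact zero_le
  have e : ∀ c : ℝ, ∫⁻ t in Set.univ.pi fun i => Set.Icc (-r i) (r i),
      Set.indicator {x : ℝ | |x| ≤ s} 1 (c + ∑ i, w i * t i) =
      volume {t : Fin n → ℝ | (∀ i, t i ∈ Set.Icc (-r i) (r i)) ∧ |c + ∑ i, w i * t i| ≤ s} := by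
    intro c
    have hm : MeasurableSet {t : Fin n → ℝ | |c + ∑ i, w i * t i| ≤ s} :=
      measurableSet_le (by fun_prop) measurable_const
    have : (fun t : Fin n → ℝ => Set.indicator {x : ℝ | |x| ≤ s} (1 : ℝ → ℝ≥0∞)
        (c + ∑ i, w i * t i)) = Set.indicator {t : Fin n → ℝ | |c + ∑ i, w i * t i| ≤ s} 1 := by
      funext t; simp [Set.indicator]
    rw [this, lintegral_indicator_one hm, Measure.restrict_apply hm]
    congr 1
    ext t
    simp only [Set.mem_inter_iff, Set.mem_univ_pi, Set.mem_ofPred_eq, and_comm]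
  rw [← e, ← e]
  exact symmDecreasing_box h r w c' c hc

theorem volume_box_slab_add_le {n : ℕ} (r w : Fin n → ℝ) (a b : ℝ) :
    volume {t : Fin n → ℝ | (∀ i, t i ∈ Set.Icc (-r i) (r i)) ∧ |∑ i, w i * t i| ≤ a + b} ≤
    volume {t : Fin n → ℝ | (∀ i, t i ∈ Set.Icc (-r i) (r i)) ∧ |∑ i, w i * t i| ≤ a} +
    volume {t : Fin n → ℝ | (∀ i, t i ∈ Set.Icc (-r i) (r i)) ∧ |∑ i, w i * t i| ≤ b} := by
  have h1 := volume_box_slab_le r w a b 0 (by simp)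
  have h2 := volume_box_slab_le r w b (-a) 0 (by simp)
  simp only [zero_add] at h1 h2
  refine le_trans (le_trans (measure_mono ?_) (measure_union_le _ _)) (add_le_add h1 h2)
  rintro t ⟨ht, hs⟩
  rw [abs_le] at hs
  rcases le_total (∑ i, w i * t i) (a - b) with h | h
  · left
    exact ⟨ht, abs_le.2 ⟨by linarith [hs.1], by linarith [hs.2]⟩⟩
  · right
    exact ⟨ht, abs_le.2 ⟨by linarith [hs.1], by linarith [hs.2]⟩⟩

/-- The half-difference set of a subset of the line; it is the centered translate when the subset
is an interval. -/
def halfDiff (J : Set ℝ) : Set ℝ := {t | ∃ a ∈ J, ∃ b ∈ J, t = (a - b) / 2}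

theorem exists_eq_Icc_of_convex_compact {J : Set ℝ} (hJ : Convex ℝ J) (hc : IsCompact J)
    (hne : J.Nonempty) : ∃ a b : ℝ, a ≤ b ∧ J = Set.Icc a b := by
  have h := eq_Icc_of_connected_compact ⟨hne, hJ.isPreconnected⟩ hc
  refine ⟨_, _, ?_, h⟩
  rw [h] at hne
  exact Set.nonempty_Icc.1 hne

theorem halfDiff_Icc (a b : ℝ) :
    halfDiff (Set.Icc a b) = Set.Icc (-((b - a) / 2)) ((b - a) / 2) := by
  ext t
  simp only [halfDiff, Set.mem_ofPred_eq, Set.mem_Icc]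
  constructor
  · rintro ⟨x, hx, y, hy, rfl⟩
    constructor <;> linarith [hx.1, hx.2, hy.1, hy.2]
  · rintro ⟨h1, h2⟩
    exact ⟨(a + b) / 2 + t, ⟨by linarith, by linarith⟩, (a + b) / 2 - t,
      ⟨by linarith, by linarith⟩, by ring⟩

theorem halfDiff_empty : halfDiff ∅ = ∅ := by
  ext; simp [halfDiff]

theorem volume_halfDiff {J : Set ℝ} (hJ : Convex ℝ J) (hc : IsCompact J) :
    volume (halfDiff J) = volume J := by
  rcases J.eq_empty_or_nonempty with rfl | hne
  · rw [halfDiff_empty]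
  · obtain ⟨a, b, hab, rfl⟩ := exists_eq_Icc_of_convex_compact hJ hc hne
    rw [halfDiff_Icc, Real.volume_Icc, Real.volume_Icc]
    congr 1; ring

theorem volume_slab_le_halfDiff {n : ℕ} {J : Fin n → Set ℝ} (hJ : ∀ i, Convex ℝ (J i))
    (hc : ∀ i, IsCompact (J i)) (w : Fin n → ℝ) (s : ℝ) :
    volume {t : Fin n → ℝ | (∀ i, t i ∈ J i) ∧ |∑ i, w i * t i| ≤ s} ≤
    volume {t : Fin n → ℝ | (∀ i, t i ∈ halfDiff (J i)) ∧ |∑ i, w i * t i| ≤ s} := by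
  by_cases hne : ∀ i, (J i).Nonempty
  · choose a b hab hJ' using fun i => exists_eq_Icc_of_convex_compact (hJ i) (hc i) (hne i)
    simp only [hJ', halfDiff_Icc]
    have h := volume_box_slab_le (fun i => (b i - a i) / 2) w s (∑ i, w i * ((a i + b i) / 2)) 0
      (by simp)
    simp only [zero_add] at h
    refine le_trans (le_of_eq ?_) h
    rw [← measure_preimage_add_right volume (fun i => (a i + b i) / 2)]
    congr 1
    ext t
    simp only [Set.mem_preimage, Set.mem_ofPred_eq, Pi.add_apply, mul_add, Finset.sum_add_distrib,
      Set.mem_Icc]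
    rw [add_comm (∑ i, w i * t i)]
    refine and_congr_left fun _ => forall_congr' fun i => ?_
    constructor <;> rintro ⟨h1, h2⟩ <;> constructor <;> linarith
  · obtain ⟨i, hi⟩ := not_forall.1 hne
    rw [Set.not_nonempty_iff_eq_empty] at hi
    have : {t : Fin n → ℝ | (∀ i, t i ∈ J i) ∧ |∑ i, w i * t i| ≤ s} = ∅ := by
      ext t
      simp only [Set.mem_ofPred_eq, Set.mem_empty_iff_false, iff_false]
      rintro ⟨h, -⟩
      simpa [hi] using h i
    rw [this]; simp

theorem volume_symm_slab_add_le {n : ℕ} {J : Fin n → Set ℝ} (hJ : ∀ i, Convex ℝ (J i))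
    (hc : ∀ i, IsCompact (J i)) (hs : ∀ i, ∀ t ∈ J i, -t ∈ J i) (w : Fin n → ℝ) (a b : ℝ) :
    volume {t : Fin n → ℝ | (∀ i, t i ∈ J i) ∧ |∑ i, w i * t i| ≤ a + b} ≤
    volume {t : Fin n → ℝ | (∀ i, t i ∈ J i) ∧ |∑ i, w i * t i| ≤ a} +
    volume {t : Fin n → ℝ | (∀ i, t i ∈ J i) ∧ |∑ i, w i * t i| ≤ b} := by
  by_cases hne : ∀ i, (J i).Nonempty
  · have : ∀ i, ∃ r : ℝ, J i = Set.Icc (-r) r := by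
      intro i
      obtain ⟨x, y, hxy, h⟩ := exists_eq_Icc_of_convex_compact (hJ i) (hc i) (hne i)
      have h1 : -x ∈ J i := hs i x (h ▸ ⟨le_rfl, hxy⟩)
      have h2 : -y ∈ J i := hs i y (h ▸ ⟨hxy, le_rfl⟩)
      rw [h] at h1 h2
      refine ⟨y, h.trans ?_⟩
      rw [show x = -y by linarith [h1.1, h1.2, h2.1, h2.2]]
    choose r hr using this
    simp only [hr]
    exact volume_box_slab_add_le r w a b
  · obtain ⟨i, hi⟩ := not_forall.1 hne
    rw [Set.not_nonempty_iff_eq_empty] at hi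
    have : {t : Fin n → ℝ | (∀ i, t i ∈ J i) ∧ |∑ i, w i * t i| ≤ a + b} = ∅ := by
      ext t
      simp only [Set.mem_ofPred_eq, Set.mem_empty_iff_false, iff_false]
      rintro ⟨h, -⟩
      simpa [hi] using h i
    rw [this]; simp

/-- In each fiber, centering moves mass into the centered interval `Y`. -/
theorem volume_halfDiff_diff_add_le {J Y : Set ℝ} (hJ : Convex ℝ J) (hc : IsCompact J)
    (hY : Convex ℝ Y) (hYc : IsCompact Y) (hYs : ∀ t ∈ Y, -t ∈ Y) (τ : ℝ) :
    volume (halfDiff J \ Y) + volume {t | t ∈ J \ Y ∧ τ + t ∈ Y \ J} ≤ volume (J \ Y) := by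
  have hm : MeasurableSet J := hc.measurableSet
  have hmY : MeasurableSet Y := hYc.measurableSet
  rcases J.eq_empty_or_nonempty with rfl | hne
  · simp [halfDiff_empty]
  rcases Y.eq_empty_or_nonempty with rfl | hneY
  · simp [volume_halfDiff hJ hc]
  obtain ⟨a, b, hab, hJe⟩ := exists_eq_Icc_of_convex_compact hJ hc hne
  obtain ⟨x, y, hxy, hYe⟩ := exists_eq_Icc_of_convex_compact hY hYc hneY
  have hx : x = -y := by
    have h1 : -x ∈ Y := hYs x (hYe ▸ ⟨le_rfl, hxy⟩)
    have h2 : -y ∈ Y := hYs y (hYe ▸ ⟨hxy, le_rfl⟩)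
    rw [hYe] at h1 h2
    linarith [h1.1, h1.2, h2.1, h2.2]
  rcases le_total ((b - a) / 2) y with h | h
  · have : halfDiff J \ Y = ∅ := by
      rw [Set.sdiff_eq_empty, hJe, halfDiff_Icc, hYe, hx]
      exact Set.Icc_subset_Icc (by linarith) h
    rw [this, measure_empty, zero_add]
    exact measure_mono fun t ht => ht.1
  · have hsub : Y ⊆ halfDiff J := by
      rw [hJe, halfDiff_Icc, hYe, hx]
      exact Set.Icc_subset_Icc (by linarith) h
    have hγ : volume {t | t ∈ J \ Y ∧ τ + t ∈ Y \ J} ≤ volume (Y \ J) := by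
      rw [← measure_preimage_add volume τ (Y \ J)]
      exact measure_mono fun t ht => ht.2
    have hfin : volume (J ∩ Y) ≠ ∞ :=
      ((measure_mono Set.inter_subset_left).trans_lt hc.measure_lt_top).ne
    have e1 : volume (halfDiff J \ Y) + volume Y = volume J := by
      rw [← volume_halfDiff hJ hc, ← measure_sdiff_add_inter (halfDiff J) hmY,
        Set.inter_eq_right.2 hsub]
    have e2 := measure_sdiff_add_inter (μ := volume) J hmY
    have e3 := measure_sdiff_add_inter (μ := volume) Y hm
    rw [Set.inter_comm] at e3
    rw [← e2, ← e3, ← add_assoc] at e1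
    rw [ENNReal.add_left_inj hfin] at e1
    rw [← e1]
    gcongr

/-- The point of `ℝ^{k+1}` with first coordinate `t` and remaining coordinates `p`. -/
def joinCoord {k : ℕ} (t : ℝ) (p : Fin k → ℝ) : Euc (k + 1) :=
  WithLp.toLp 2 (Fin.cons t p : Fin (k + 1) → ℝ)

/-- All coordinates of a point but the first. -/
def tailCoord {k : ℕ} (x : Euc (k + 1)) : Fin k → ℝ := fun j => x j.succ

@[simp] theorem joinCoord_zero {k : ℕ} (t : ℝ) (p : Fin k → ℝ) : joinCoord t p 0 = t := rfl

@[simp] theorem joinCoord_succ {k : ℕ} (t : ℝ) (p : Fin k → ℝ) (j : Fin k) :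
    joinCoord t p j.succ = p j := rfl

@[simp] theorem tailCoord_joinCoord {k : ℕ} (t : ℝ) (p : Fin k → ℝ) :
    tailCoord (joinCoord t p) = p := rfl

@[simp] theorem joinCoord_tailCoord {k : ℕ} (x : Euc (k + 1)) :
    joinCoord (x 0) (tailCoord x) = x := by
  ext j
  refine Fin.cases rfl (fun j => rfl) j

theorem eq_joinCoord {k : ℕ} {x : Euc (k + 1)} {t : ℝ} {p : Fin k → ℝ} (h0 : x 0 = t)
    (hp : tailCoord x = p) : x = joinCoord t p := by
  subst h0 hp; simp

theorem continuous_joinCoord {k : ℕ} :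
    Continuous fun z : (Fin k → ℝ) × ℝ => joinCoord z.2 z.1 := by
  unfold joinCoord
  refine (PiLp.continuous_toLp 2 _).comp ?_
  refine continuous_pi fun j => ?_
  refine Fin.cases ?_ (fun j => ?_) j
  · exact continuous_snd
  · exact (continuous_apply j).comp continuous_fst

theorem continuous_tailCoord {k : ℕ} : Continuous (tailCoord (k := k)) := by
  unfold tailCoord; fun_prop

theorem measurePreserving_joinCoord {k : ℕ} :
    MeasurePreserving (fun z : (Fin k → ℝ) × ℝ => joinCoord z.2 z.1) := by
  have h1 := (volume_preserving_piFinSuccAbove (fun _ : Fin (k + 1) => ℝ) 0).symm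
  have h2 := (PiLp.volume_preserving_toLp (Fin (k + 1))).comp h1
  have h3 := h2.comp (Measure.measurePreserving_swap (μ := (volume : Measure (Fin k → ℝ)))
    (ν := (volume : Measure ℝ)))
  convert h3 using 1
  · funext z
    ext j
    refine Fin.cases ?_ (fun j => ?_) j
    · simp [MeasurableEquiv.piFinSuccAbove, Fin.consEquiv, joinCoord]
    · simp [MeasurableEquiv.piFinSuccAbove, Fin.consEquiv, joinCoord]
  · exact Measure.volume_eq_prod _ _

/-- Assemble points from their first coordinates and their remaining coordinates. -/
def joinAll {k n : ℕ} (z : (Fin n → Fin k → ℝ) × (Fin n → ℝ)) : Fin n → Euc (k + 1) :=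
  fun i => joinCoord (z.2 i) (z.1 i)

theorem measurePreserving_joinAll {k n : ℕ} : MeasurePreserving (joinAll (k := k) (n := n)) := by
  have h1 := (volume_measurePreserving_arrowProdEquivProdArrow (Fin k → ℝ) ℝ (Fin n)).symm
  have h2 := volume_preserving_pi (fun _ : Fin n => measurePreserving_joinCoord (k := k))
  exact h2.comp h1

/-- The fiber of a set over the last coordinates. -/
def fiber {k : ℕ} (K : Set (Euc (k + 1))) (p : Fin k → ℝ) : Set ℝ := {t | joinCoord t p ∈ K}

theorem convex_fiber {k : ℕ} {K : Set (Euc (k + 1))} (hK : Convex ℝ K) (p : Fin k → ℝ) :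
    Convex ℝ (fiber K p) := by
  intro s hs t ht a b ha hb hab
  have := hK hs ht ha hb hab
  change joinCoord _ _ ∈ K
  convert this using 1
  ext j
  refine Fin.cases ?_ (fun j => ?_) j
  · simp
  · simp [← add_mul, hab]

theorem isClosed_fiber {k : ℕ} {K : Set (Euc (k + 1))} (hK : IsClosed K) (p : Fin k → ℝ) :
    IsClosed (fiber K p) :=
  hK.preimage (continuous_joinCoord.comp (by fun_prop : Continuous fun t : ℝ => (p, t)))

theorem isCompact_fiber {k : ℕ} {K : Set (Euc (k + 1))} (hK : IsCompact K) (p : Fin k → ℝ) :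
    IsCompact (fiber K p) := by
  have h1 : IsCompact ((fun x : Euc (k + 1) => x 0) '' K) := hK.image (by fun_prop)
  exact h1.of_isClosed_subset (isClosed_fiber hK.isClosed p) fun t ht => ⟨_, ht, rfl⟩

/-- Steiner symmetrization with respect to the hyperplane where the first coordinate vanishes. -/
def steiner {k : ℕ} (K : Set (Euc (k + 1))) : Set (Euc (k + 1)) :=
  {x | x 0 ∈ halfDiff (fiber K (tailCoord x))}

@[simp] theorem fiber_steiner {k : ℕ} (K : Set (Euc (k + 1))) (p : Fin k → ℝ) :
    fiber (steiner K) p = halfDiff (fiber K p) := rfl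

theorem mem_steiner_iff {k : ℕ} {K : Set (Euc (k + 1))} {z : Euc (k + 1)} :
    z ∈ steiner K ↔ ∃ x ∈ K, ∃ y ∈ K, tailCoord x = tailCoord y ∧
      z = joinCoord ((x 0 - y 0) / 2) (tailCoord x) := by
  constructor
  · rintro ⟨a, ha, b, hb, h⟩
    exact ⟨_, ha, _, hb, rfl, eq_joinCoord h rfl⟩
  · rintro ⟨x, hx, y, hy, hxy, rfl⟩
    refine ⟨x 0, ?_, y 0, ?_, rfl⟩
    · change joinCoord _ _ ∈ K
      simpa using hx
    · change joinCoord _ _ ∈ K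
      rw [tailCoord_joinCoord, hxy]
      simpa using hy

theorem convex_steiner {k : ℕ} {K : Set (Euc (k + 1))} (hK : Convex ℝ K) :
    Convex ℝ (steiner K) := by
  intro z hz z' hz' a b ha hb hab
  rw [mem_steiner_iff] at hz hz' ⊢
  obtain ⟨x, hx, y, hy, hxy, rfl⟩ := hz
  obtain ⟨x', hx', y', hy', hxy', rfl⟩ := hz'
  refine ⟨_, hK hx hx' ha hb hab, _, hK hy hy' ha hb hab, ?_, ?_⟩
  · funext j
    have h1 := congrFun hxy j
    have h2 := congrFun hxy' j
    simp only [tailCoord] at h1 h2 ⊢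
    simp [h1, h2]
  · ext j
    refine Fin.cases ?_ (fun j => ?_) j
    · simp; ring
    · simp [tailCoord]

theorem isCompact_steiner {k : ℕ} {K : Set (Euc (k + 1))} (hK : IsCompact K) :
    IsCompact (steiner K) := by
  have h1 : IsCompact ((K ×ˢ K) ∩ {z | tailCoord z.1 = tailCoord z.2}) :=
    (hK.prod hK).inter_right (isClosed_eq (continuous_tailCoord.comp continuous_fst)
      (continuous_tailCoord.comp continuous_snd))
  have h2 : Continuous fun z : Euc (k + 1) × Euc (k + 1) =>
      joinCoord ((z.1 0 - z.2 0) / 2) (tailCoord z.1) :=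
    continuous_joinCoord.comp ((continuous_tailCoord.comp continuous_fst).prodMk (by fun_prop))
  convert h1.image h2 using 1
  ext z
  rw [mem_steiner_iff]
  constructor
  · rintro ⟨x, hx, y, hy, hxy, rfl⟩
    exact ⟨(x, y), ⟨⟨hx, hy⟩, hxy⟩, rfl⟩
  · rintro ⟨⟨x, y⟩, ⟨⟨hx, hy⟩, hxy⟩, rfl⟩
    exact ⟨x, hx, y, hy, hxy, rfl⟩

theorem neg_mem_halfDiff {J : Set ℝ} {t : ℝ} (ht : t ∈ halfDiff J) : -t ∈ halfDiff J := by
  obtain ⟨a, ha, b, hb, rfl⟩ := ht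
  exact ⟨b, hb, a, ha, by ring⟩

theorem steiner_subset_closedBall {k : ℕ} {K : Set (Euc (k + 1))} {R : ℝ}
    (hK : K ⊆ Metric.closedBall 0 R) : steiner K ⊆ Metric.closedBall 0 R := by
  intro z hz
  rw [mem_steiner_iff] at hz
  obtain ⟨x, hx, y, hy, hxy, rfl⟩ := hz
  have key : joinCoord ((x 0 - y 0) / 2) (tailCoord x) =
      (1 / 2 : ℝ) • x + (1 / 2 : ℝ) • joinCoord (-(y 0)) (tailCoord y) := by
    ext j
    refine Fin.cases ?_ (fun j => ?_) j
    · simp; ring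
    · simp [← hxy, tailCoord]; ring
  rw [key]
  have hn : ‖joinCoord (-(y 0)) (tailCoord y)‖ = ‖y‖ := by
    rw [EuclideanSpace.norm_eq, EuclideanSpace.norm_eq]
    congr 1
    rw [Fin.sum_univ_succ, Fin.sum_univ_succ]
    simp [tailCoord]
  refine convex_closedBall (0 : Euc (k + 1)) R (hK hx) ?_ (by norm_num) (by norm_num) (by norm_num)
  have := hK hy
  simpa [hn] using this

/-- The determinant of the edge vectors at the first vertex of a simplex. -/
noncomputable def edgeDet {d : ℕ} (x : Fin (d + 1) → Euc d) : ℝ :=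
  Matrix.det (Matrix.of fun i j : Fin d => x i.succ j - x 0 j)

theorem continuous_edgeDet {d : ℕ} : Continuous (edgeDet (d := d)) := by
  unfold edgeDet
  refine Continuous.matrix_det ?_
  refine continuous_matrix fun i j => ?_
  simp only [Matrix.of_apply]
  fun_prop

theorem exists_edgeDet_eq_sum {k : ℕ} (p : Fin (k + 2) → Fin k → ℝ) :
    ∃ w : Fin (k + 2) → ℝ, ∀ t : Fin (k + 2) → ℝ, edgeDet (joinAll (p, t)) = ∑ i, w i * t i := by
  let a : Fin (k + 1) → ℝ := fun i => (-1) ^ (i : ℕ) *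
    Matrix.det (Matrix.of fun (l j : Fin k) => p (i.succAbove l).succ j - p 0 j)
  refine ⟨Fin.cons (-∑ i, a i) a, fun t => ?_⟩
  rw [edgeDet, Matrix.det_succ_column_zero, Fin.sum_univ_succ (f := fun i => _ * t i)]
  simp only [Fin.cons_zero, Fin.cons_succ]
  rw [neg_mul, Finset.sum_mul, neg_add_eq_sub, ← Finset.sum_sub_distrib]
  refine Finset.sum_congr rfl fun i _ => ?_
  simp only [a]
  have : (Matrix.of fun i j : Fin (k + 1) => joinAll (p, t) i.succ j -
      joinAll (p, t) 0 j).submatrix i.succAbove Fin.succ =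
      Matrix.of fun (l j : Fin k) => p (i.succAbove l).succ j - p 0 j := by
    ext l j
    simp [joinAll]
  rw [this]
  simp [joinAll]
  ring

/-- Tuples of points of `K` whose tails lie in `Q` and whose edge determinant is at most `s`. -/
def thinSet {k : ℕ} (K : Set (Euc (k + 1))) (Q : Set (Fin (k + 2) → Fin k → ℝ)) (s : ℝ) :
    Set (Fin (k + 2) → Euc (k + 1)) :=
  {x | (∀ i, x i ∈ K) ∧ (fun i => tailCoord (x i)) ∈ Q ∧ |edgeDet x| ≤ s}

theorem measurableSet_thinSet {k : ℕ} {K : Set (Euc (k + 1))} (hK : MeasurableSet K)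
    {Q : Set (Fin (k + 2) → Fin k → ℝ)} (hQ : MeasurableSet Q) (s : ℝ) :
    MeasurableSet (thinSet K Q s) := by
  have h1 : MeasurableSet {x : Fin (k + 2) → Euc (k + 1) | ∀ i, x i ∈ K} := by
    simp only [Set.ofPred_forall]
    exact MeasurableSet.iInter fun i => (measurable_pi_apply i) hK
  have h2 : Measurable fun x : Fin (k + 2) → Euc (k + 1) => fun i => tailCoord (x i) :=
    measurable_pi_lambda _ fun i => continuous_tailCoord.measurable.comp (measurable_pi_apply i)
  have h3 : MeasurableSet {x : Fin (k + 2) → Euc (k + 1) | |edgeDet x| ≤ s} :=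
    measurableSet_le continuous_edgeDet.abs.measurable measurable_const
  exact h1.inter ((h2 hQ).inter h3)

theorem volume_thinSet {k : ℕ} {K : Set (Euc (k + 1))} (hK : MeasurableSet K)
    {Q : Set (Fin (k + 2) → Fin k → ℝ)} (hQ : MeasurableSet Q) (s : ℝ) :
    volume (thinSet K Q s) = ∫⁻ p in Q, volume {t : Fin (k + 2) → ℝ |
      (∀ i, t i ∈ fiber K (p i)) ∧ |edgeDet (joinAll (p, t))| ≤ s} := by
  have hm := measurableSet_thinSet hK hQ s
  rw [← measurePreserving_joinAll.measure_preimage hm.nullMeasurableSet, Measure.volume_eq_prod,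
    Measure.prod_apply (measurePreserving_joinAll.measurable hm), ← lintegral_indicator hQ]
  refine lintegral_congr fun p => ?_
  by_cases hp : p ∈ Q
  · rw [Set.indicator_of_mem hp]
    congr 1
    ext t
    simp only [Set.mem_preimage, thinSet, Set.mem_ofPred_eq, fiber]
    constructor
    · rintro ⟨h1, -, h3⟩; exact ⟨h1, h3⟩
    · rintro ⟨h1, h3⟩; exact ⟨h1, hp, h3⟩
  · rw [Set.indicator_of_notMem hp]
    convert measure_empty (μ := (volume : Measure (Fin (k + 2) → ℝ)))
    ext t
    simp only [Set.mem_preimage, thinSet, Set.mem_ofPred_eq, Set.mem_empty_iff_false, iff_false]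
    rintro ⟨-, h, -⟩
    exact hp h

theorem volume_thinSet_le_steiner {k : ℕ} {K : Set (Euc (k + 1))} (hK : Convex ℝ K)
    (hc : IsCompact K) {Q : Set (Fin (k + 2) → Fin k → ℝ)} (hQ : MeasurableSet Q) (s : ℝ) :
    volume (thinSet K Q s) ≤ volume (thinSet (steiner K) Q s) := by
  rw [volume_thinSet hc.measurableSet hQ, volume_thinSet (isCompact_steiner hc).measurableSet hQ]
  refine lintegral_mono fun p => ?_
  obtain ⟨w, hw⟩ := exists_edgeDet_eq_sum p
  simp only [hw, fiber_steiner]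
  exact volume_slab_le_halfDiff (fun i => convex_fiber hK _) (fun i => isCompact_fiber hc _) w s

theorem volume_thinSet_add_le {k : ℕ} {K : Set (Euc (k + 1))} (hK : Convex ℝ K)
    (hc : IsCompact K) (hs : ∀ p, ∀ t ∈ fiber K p, -t ∈ fiber K p)
    {Q : Set (Fin (k + 2) → Fin k → ℝ)} (hQ : MeasurableSet Q) (a b : ℝ) :
    volume (thinSet K Q (a + b)) ≤ volume (thinSet K Q a) + volume (thinSet K Q b) := by
  rw [volume_thinSet hc.measurableSet hQ, volume_thinSet hc.measurableSet hQ,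
    volume_thinSet hc.measurableSet hQ]
  refine le_trans (lintegral_mono fun p => ?_) (lintegral_add_left' ?_ _).le
  · obtain ⟨w, hw⟩ := exists_edgeDet_eq_sum p
    simp only [hw]
    exact volume_symm_slab_add_le (fun i => convex_fiber hK _) (fun i => isCompact_fiber hc _)
      (fun i => hs _) w a b
  · have hm := measurableSet_thinSet hc.measurableSet MeasurableSet.univ a
    have := measurable_measure_prodMk_left (ν := (volume : Measure (Fin (k + 2) → ℝ)))
      ((measurePreserving_joinAll (k := k)).measurable hm)
    refine this.aemeasurable.congr (Eventually.of_forall fun p => congrArg volume ?_)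
    ext t
    simp [thinSet, joinAll, fiber]

theorem volume_eq_lintegral_fiber {k : ℕ} {L : Set (Euc (k + 1))} (hL : MeasurableSet L) :
    volume L = ∫⁻ p, volume (fiber L p) := by
  rw [← measurePreserving_joinCoord.measure_preimage hL.nullMeasurableSet,
    Measure.volume_eq_prod, Measure.prod_apply (measurePreserving_joinCoord.measurable hL)]
  rfl

theorem volume_steiner {k : ℕ} {K : Set (Euc (k + 1))} (hK : Convex ℝ K) (hc : IsCompact K) :
    volume (steiner K) = volume K := by
  rw [volume_eq_lintegral_fiber hc.measurableSet,
    volume_eq_lintegral_fiber (isCompact_steiner hc).measurableSet]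
  exact lintegral_congr fun p => volume_halfDiff (convex_fiber hK p) (isCompact_fiber hc p)

theorem volume_steiner_diff_add_le {k : ℕ} {K Y : Set (Euc (k + 1))} (hK : Convex ℝ K)
    (hc : IsCompact K) (hY : Convex ℝ Y) (hYc : IsCompact Y)
    (hYs : ∀ p, ∀ t ∈ fiber Y p, -t ∈ fiber Y p) (τ : ℝ) :
    volume (steiner K \ Y) + volume {x | x ∈ K \ Y ∧ joinCoord τ 0 + x ∈ Y \ K} ≤
      volume (K \ Y) := by
  have m1 := (isCompact_steiner hc).measurableSet.diff hYc.measurableSet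
  have m2 := hc.measurableSet.diff hYc.measurableSet
  have m3 : MeasurableSet {x | x ∈ K \ Y ∧ joinCoord τ 0 + x ∈ Y \ K} :=
    m2.inter ((measurable_const_add _) (hYc.measurableSet.diff hc.measurableSet))
  rw [volume_eq_lintegral_fiber m1, volume_eq_lintegral_fiber m2, volume_eq_lintegral_fiber m3, ← lintegral_add_left]
  · refine lintegral_mono fun p => ?_
    have := volume_halfDiff_diff_add_le (convex_fiber hK p) (isCompact_fiber hc p)
      (convex_fiber hY p) (isCompact_fiber hYc p) (hYs p) τ
    refine le_trans (le_of_eq ?_) this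
    congr 2
    ext t
    have : joinCoord τ 0 + joinCoord t p = joinCoord (τ + t) p := by
      ext j
      refine Fin.cases ?_ (fun j => ?_) j <;> simp
    simp only [fiber, Set.mem_ofPred_eq, this, Set.mem_sdiff]
  · exact measurable_measure_prodMk_left (measurePreserving_joinCoord.measurable m1)

/-- Tuples of points of `K` whose edge determinant is at most `s`. -/
def smallSet {d : ℕ} (K : Set (Euc d)) (s : ℝ) : Set (Fin (d + 1) → Euc d) :=
  {x | (∀ i, x i ∈ K) ∧ |edgeDet x| ≤ s}

theorem thinSet_univ {k : ℕ} (K : Set (Euc (k + 1))) (s : ℝ) :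
    thinSet K Set.univ s = smallSet K s := by
  ext x; simp [thinSet, smallSet]

theorem edgeDet_map_add {d : ℕ} (L : Euc d →ₗ[ℝ] Euc d) (c : Euc d) (x : Fin (d + 1) → Euc d) :
    edgeDet (fun i => L (x i) + c) = LinearMap.det L * edgeDet x := by
  rw [← LinearMap.det_toMatrix (EuclideanSpace.basisFun (Fin d) ℝ).toBasis, edgeDet, edgeDet,
    ← Matrix.det_transpose (LinearMap.toMatrix _ _ L), mul_comm, ← Matrix.det_mul]
  congr 1
  ext i j
  have h := LinearMap.toMatrix_mulVec_repr (EuclideanSpace.basisFun (Fin d) ℝ).toBasis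
    (EuclideanSpace.basisFun (Fin d) ℝ).toBasis L (x i.succ - x 0)
  have h' := congrFun h j
  simp only [OrthonormalBasis.coe_toBasis_repr_apply, EuclideanSpace.basisFun_repr] at h'
  simp only [Matrix.of_apply, Matrix.mul_apply, Matrix.transpose_apply]
  have e : (L (x i.succ) + c).ofLp j - (L (x 0) + c).ofLp j = (L (x i.succ - x 0)).ofLp j := by
    simp
  rw [e, ← h', Matrix.mulVec, dotProduct]
  refine Finset.sum_congr rfl fun l _ => ?_
  simp [mul_comm]

theorem abs_det_linearIsometryEquiv {d : ℕ} (σ : Euc d ≃ₗᵢ[ℝ] Euc d) :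
    |LinearMap.det (σ.toLinearEquiv : Euc d →ₗ[ℝ] Euc d)| = 1 := by
  have h := Measure.addHaar_image_linearMap (volume : Measure (Euc d))
    (σ.toLinearEquiv : Euc d →ₗ[ℝ] Euc d) (Metric.closedBall 0 1)
  have e : ((σ.toLinearEquiv : Euc d →ₗ[ℝ] Euc d) : Euc d → Euc d) '' Metric.closedBall 0 1 =
      Metric.closedBall 0 1 := by
    have := σ.image_closedBall 0 1
    rw [map_zero] at this
    exact this
  rw [e] at h
  have h0 : volume (Metric.closedBall (0 : Euc d) 1) ≠ 0 :=
    (Metric.measure_closedBall_pos _ _ one_pos).ne'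
  have h1 : volume (Metric.closedBall (0 : Euc d) 1) ≠ ∞ :=
    (isCompact_closedBall _ _).measure_lt_top.ne
  have h2 : ENNReal.ofReal |LinearMap.det (σ.toLinearEquiv : Euc d →ₗ[ℝ] Euc d)| = 1 := by
    have := (ENNReal.eq_div_iff h0 h1).2 ((mul_comm _ _).trans h.symm)
    rw [this, ENNReal.div_self h0 h1]
  simpa using h2

theorem smallSet_preimage {d : ℕ} (σ : Euc d ≃ₗᵢ[ℝ] Euc d) (K : Set (Euc d)) (s : ℝ) :
    smallSet (σ ⁻¹' K) s = (fun x i => σ (x i)) ⁻¹' smallSet K s := by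
  ext x
  have h := edgeDet_map_add (σ.toLinearEquiv : Euc d →ₗ[ℝ] Euc d) 0 x
  have h' : |edgeDet fun i => σ (x i)| = |edgeDet x| := by
    simp only [add_zero] at h
    refine (congrArg abs h).trans ?_
    rw [abs_mul, abs_det_linearIsometryEquiv, one_mul]
  simp [smallSet, h']

theorem measurableSet_smallSet {d : ℕ} {K : Set (Euc d)} (hK : MeasurableSet K) (s : ℝ) :
    MeasurableSet (smallSet K s) := by
  have h1 : MeasurableSet {x : Fin (d + 1) → Euc d | ∀ i, x i ∈ K} := by
    simp only [Set.ofPred_forall]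
    exact MeasurableSet.iInter fun i => (measurable_pi_apply i) hK
  exact h1.inter (measurableSet_le continuous_edgeDet.abs.measurable measurable_const)

theorem volume_smallSet_preimage {d : ℕ} (σ : Euc d ≃ₗᵢ[ℝ] Euc d) {K : Set (Euc d)}
    (hK : MeasurableSet K) (s : ℝ) :
    volume (smallSet (σ ⁻¹' K) s) = volume (smallSet K s) := by
  rw [smallSet_preimage]
  exact (volume_preserving_pi fun _ : Fin (d + 1) => σ.measurePreserving).measure_preimage
    (measurableSet_smallSet hK s).nullMeasurableSet

theorem exists_linearIsometryEquiv_joinCoord {k : ℕ} (u : Euc (k + 1)) :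
    ∃ σ : Euc (k + 1) ≃ₗᵢ[ℝ] Euc (k + 1), σ (joinCoord ‖u‖ 0) = u := by
  refine ⟨_, Submodule.reflection_sub ?_⟩
  rw [EuclideanSpace.norm_eq, Fin.sum_univ_succ]
  simp

theorem preimage_closedBall_zero {d : ℕ} (σ : Euc d ≃ₗᵢ[ℝ] Euc d) (r : ℝ) :
    σ ⁻¹' Metric.closedBall 0 r = Metric.closedBall 0 r := by
  ext x; simp

theorem fiber_closedBall_symm {k : ℕ} (r : ℝ) (p : Fin k → ℝ) :
    ∀ t ∈ fiber (Metric.closedBall 0 r) p, -t ∈ fiber (Metric.closedBall 0 r) p := by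
  intro t ht
  have : ‖joinCoord (-t) p‖ = ‖joinCoord t p‖ := by
    rw [EuclideanSpace.norm_eq, EuclideanSpace.norm_eq, Fin.sum_univ_succ, Fin.sum_univ_succ]
    simp
  simpa [fiber, this] using ht

theorem lintegral_volume_inter_translate {d : ℕ} {X Y : Set (Euc d)} (hX : MeasurableSet X)
    (hY : MeasurableSet Y) :
    ∫⁻ u, volume {x | x ∈ X ∧ u + x ∈ Y} = volume X * volume Y := by
  have hm : MeasurableSet {z : Euc d × Euc d | z.2 ∈ X ∧ z.1 + z.2 ∈ Y} :=
    (measurable_snd hX).inter ((measurable_fst.add measurable_snd) hY)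
  have h1 := Measure.prod_apply (μ := (volume : Measure (Euc d)))
    (ν := (volume : Measure (Euc d))) hm
  have h2 := Measure.prod_apply_symm (μ := (volume : Measure (Euc d)))
    (ν := (volume : Measure (Euc d))) hm
  calc ∫⁻ u, volume {x | x ∈ X ∧ u + x ∈ Y} = _ := h1.symm
    _ = _ := h2
    _ = ∫⁻ x, X.indicator (fun _ => volume Y) x := by
      refine lintegral_congr fun x => ?_
      by_cases hx : x ∈ X
      · rw [Set.indicator_of_mem hx, ← measure_preimage_add_right volume x Y]
        congr 1
        ext u
        simp [hx]
      · rw [Set.indicator_of_notMem hx]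
        convert measure_empty (μ := (volume : Measure (Euc d)))
        ext u
        simp [hx]
    _ = _ := by rw [lintegral_indicator hX, setLIntegral_const, mul_comm]

theorem exists_steiner_improvement {k : ℕ} {A : Set (Euc (k + 1))} (hA : Convex ℝ A)
    (hc : IsCompact A) {R r : ℝ} (hR : A ⊆ Metric.closedBall 0 R)
    (hv : volume A = volume (Metric.closedBall (0 : Euc (k + 1)) r)) {η : ℝ≥0∞}
    (hη : η * volume (Metric.closedBall (0 : Euc (k + 1)) (R + r)) <
      volume (A \ Metric.closedBall 0 r) * volume (A \ Metric.closedBall 0 r)) :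
    ∃ A' : Set (Euc (k + 1)), Convex ℝ A' ∧ IsCompact A' ∧ A' ⊆ Metric.closedBall 0 R ∧
      volume A' = volume A ∧ (∀ s, volume (smallSet A s) ≤ volume (smallSet A' s)) ∧
      volume (A' \ Metric.closedBall 0 r) + η ≤ volume (A \ Metric.closedBall 0 r) := by
  set Y := Metric.closedBall (0 : Euc (k + 1)) r with hYdef
  have hYc : IsCompact Y := isCompact_closedBall _ _
  have hYm : MeasurableSet Y := hYc.measurableSet
  have hAm : MeasurableSet A := hc.measurableSet
  have hdiff : volume (Y \ A) = volume (A \ Y) := by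
    have e2 := measure_sdiff_add_inter (μ := volume) A hYm
    have e3 := measure_sdiff_add_inter (μ := volume) Y hAm
    rw [Set.inter_comm, ← hv, ← e2] at e3
    refine (ENNReal.add_left_inj ?_).1 e3
    exact ((measure_mono Set.inter_subset_left).trans_lt hc.measure_lt_top).ne
  obtain ⟨u, hu⟩ : ∃ u, η < volume {x | x ∈ A \ Y ∧ u + x ∈ Y \ A} := by
    by_contra hcon
    push Not at hcon
    refine absurd hη (not_lt.2 ?_)
    have h1 := lintegral_volume_inter_translate (hAm.diff hYm) (hYm.diff hAm)
    rw [hdiff] at h1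
    rw [← h1]
    calc ∫⁻ u, volume {x | x ∈ A \ Y ∧ u + x ∈ Y \ A}
        ≤ ∫⁻ u, (Metric.closedBall (0 : Euc (k + 1)) (R + r)).indicator (fun _ => η) u := by
          refine lintegral_mono fun u => ?_
          by_cases hu : u ∈ Metric.closedBall (0 : Euc (k + 1)) (R + r)
          · rw [Set.indicator_of_mem hu]; exact hcon u
          · rw [Set.indicator_of_notMem hu, nonpos_iff_eq_zero]
            convert measure_empty (μ := (volume : Measure (Euc (k + 1))))
            ext x
            simp only [Set.mem_ofPred_eq, Set.mem_empty_iff_false, iff_false]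
            rintro ⟨hx, hux⟩
            apply hu
            have h2 : ‖x‖ ≤ R := by simpa using hR hx.1
            have h3 : ‖u + x‖ ≤ r := by simpa [hYdef] using hux.1
            have h4 : ‖u‖ ≤ ‖u + x‖ + ‖x‖ := by simpa using norm_sub_le (u + x) x
            simp only [mem_closedBall_zero_iff]
            linarith
      _ = _ := by rw [lintegral_indicator (isCompact_closedBall _ _).measurableSet,
                    setLIntegral_const]
  obtain ⟨σ, hσ⟩ := exists_linearIsometryEquiv_joinCoord u
  have hσY : σ ⁻¹' Y = Y := preimage_closedBall_zero σ r
  have hA1 : Convex ℝ (σ ⁻¹' A) :=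
    hA.linear_preimage (σ.toLinearEquiv : Euc (k + 1) →ₗ[ℝ] Euc (k + 1))
  have hc1 : IsCompact (σ ⁻¹' A) := σ.toHomeomorph.isCompact_preimage.2 hc
  refine ⟨steiner (σ ⁻¹' A), convex_steiner hA1, isCompact_steiner hc1, ?_, ?_, ?_, ?_⟩
  · refine steiner_subset_closedBall ?_
    rw [← preimage_closedBall_zero σ R]
    exact Set.preimage_mono hR
  · rw [volume_steiner hA1 hc1]
    exact σ.measurePreserving.measure_preimage hAm.nullMeasurableSet
  · intro s
    rw [← volume_smallSet_preimage σ hAm, ← thinSet_univ, ← thinSet_univ]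
    exact volume_thinSet_le_steiner hA1 hc1 MeasurableSet.univ s
  · have h := volume_steiner_diff_add_le hA1 hc1 (convex_closedBall (0 : Euc (k + 1)) r) hYc
      (fiber_closedBall_symm r) ‖u‖
    have e1 : volume (σ ⁻¹' A \ Y) = volume (A \ Y) := by
      conv_lhs => rw [← hσY]
      rw [← Set.preimage_sdiff]
      exact σ.measurePreserving.measure_preimage (hAm.diff hYm).nullMeasurableSet
    have e2 : volume {x | x ∈ σ ⁻¹' A \ Y ∧ joinCoord ‖u‖ 0 + x ∈ Y \ σ ⁻¹' A} =
        volume {x | x ∈ A \ Y ∧ u + x ∈ Y \ A} := by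
      have hm : MeasurableSet {x | x ∈ A \ Y ∧ u + x ∈ Y \ A} :=
        (hAm.diff hYm).inter ((measurable_const_add _) (hYm.diff hAm))
      rw [← σ.measurePreserving.measure_preimage hm.nullMeasurableSet]
      congr 1
      ext x
      have h1 : σ (joinCoord ‖u‖ 0 + x) = u + σ x := by rw [map_add, hσ]
      have h2 : ‖joinCoord ‖u‖ 0 + x‖ = ‖u + σ x‖ := by rw [← h1, σ.norm_map]
      simp [hYdef, h2, hσ]
    rw [← hYdef, e1, e2] at h
    exact le_trans (by gcongr) h

theorem volume_smallSet_le_add {d : ℕ} {A Y : Set (Euc d)} (hA : volume A = 1) (s : ℝ) :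
    volume (smallSet A s) ≤ volume (smallSet Y s) + (d + 1 : ℕ) * volume (A \ Y) := by
  have hsub : smallSet A s ⊆ smallSet Y s ∪
      ⋃ i : Fin (d + 1), Set.univ.pi fun j => if j = i then A \ Y else A := by
    rintro x ⟨hx, hs⟩
    by_cases h : ∀ i, x i ∈ Y
    · exact Or.inl ⟨h, hs⟩
    · right
      obtain ⟨i, hi⟩ := not_forall.1 h
      refine Set.mem_iUnion.2 ⟨i, fun j _ => ?_⟩
      by_cases hj : j = i
      · simp only [hj, if_true]; exact ⟨hx i, hi⟩
      · simp only [hj, if_false]; exact hx j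
  refine (measure_mono hsub).trans ((measure_union_le _ _).trans ?_)
  gcongr
  refine (measure_iUnion_fintype_le _ _).trans ?_
  have : ∀ i : Fin (d + 1), volume (Set.univ.pi fun j => if j = i then A \ Y else A) =
      volume (A \ Y) := by
    intro i
    rw [volume_pi_pi, Finset.prod_eq_single i]
    · simp
    · intro j _ hj; simp [hj, hA]
    · simp
  simp [this]

/-- Among compact convex sets of unit volume, a ball contains the most simplices of small volume. -/
theorem volume_smallSet_le_closedBall {k : ℕ} {K : Set (Euc (k + 1))} (hK : Convex ℝ K)
    (hc : IsCompact K) (hv : volume K = 1) {r : ℝ}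
    (hr : volume (Metric.closedBall (0 : Euc (k + 1)) r) = 1) (s : ℝ) :
    volume (smallSet K s) ≤ volume (smallSet (Metric.closedBall (0 : Euc (k + 1)) r) s) := by
  set Y := Metric.closedBall (0 : Euc (k + 1)) r with hYdef
  obtain ⟨R', hR'⟩ := hc.isBounded.subset_closedBall 0
  obtain ⟨R, hR, hRr⟩ : ∃ R, K ⊆ Metric.closedBall 0 R ∧ 0 < R + r :=
    ⟨max R' (1 - r), hR'.trans (Metric.closedBall_subset_closedBall (le_max_left _ _)),
      by linarith [le_max_right R' (1 - r)]⟩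
  let C : Set (Set (Euc (k + 1))) := {A | Convex ℝ A ∧ IsCompact A ∧ A ⊆ Metric.closedBall 0 R ∧
    volume A = 1 ∧ volume (smallSet K s) ≤ volume (smallSet A s)}
  have hKC : K ∈ C := ⟨hK, hc, hR, hv, le_rfl⟩
  set I : ℝ≥0∞ := ⨅ A ∈ C, volume (A \ Y) with hI
  have hIle : I ≤ 1 := by
    rw [← hv]
    exact (iInf₂_le K hKC).trans (measure_mono Set.sdiff_subset)
  have hItop : I ≠ ∞ := (hIle.trans_lt ENNReal.one_lt_top).ne
  set V := volume (Metric.closedBall (0 : Euc (k + 1)) (R + r)) with hV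
  have hV0 : V ≠ 0 := (Metric.measure_closedBall_pos _ _ hRr).ne'
  have hVtop : V ≠ ∞ := (isCompact_closedBall _ _).measure_lt_top.ne
  have hI0 : I = 0 := by
    by_contra h0
    have hI2 : I * I ≠ 0 := mul_ne_zero h0 h0
    have hI2top : I * I ≠ ∞ := ENNReal.mul_ne_top hItop hItop
    set η := I * I / 2 / V with hη
    have hη0 : η ≠ 0 := by
      simp [hη, ENNReal.div_eq_zero_iff, h0, hVtop]
    have hηV : η * V = I * I / 2 := ENNReal.div_mul_cancel hV0 hVtop
    have hall : I + η ≤ I := by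
      conv_rhs => rw [hI]
      refine le_iInf₂ fun A hA => ?_
      obtain ⟨a1, a2, a3, a4, a5⟩ := hA
      have hIA : I ≤ volume (A \ Y) := iInf₂_le A ⟨a1, a2, a3, a4, a5⟩
      have hlt : η * V < volume (A \ Y) * volume (A \ Y) := by
        rw [hηV]
        exact (ENNReal.half_lt_self hI2 hI2top).trans_le (mul_le_mul' hIA hIA)
      obtain ⟨A', b1, b2, b3, b4, b5, b6⟩ :=
        exists_steiner_improvement a1 a2 a3 (a4.trans hr.symm) hlt
      exact le_trans (add_le_add_left (iInf₂_le A' ⟨b1, b2, b3, b4.trans a4, a5.trans (b5 s)⟩) η) b6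
    exact (ENNReal.lt_add_right hItop hη0).not_ge hall
  refine ENNReal.le_of_forall_pos_le_add fun ε hε _ => ?_
  have hpos : I < (ε : ℝ≥0∞) / ((k + 1 + 1 : ℕ) : ℝ≥0∞) := by
    rw [hI0]
    exact ENNReal.div_pos (by simpa using hε.ne') (by simp)
  obtain ⟨A, hAlt⟩ := iInf_lt_iff.1 hpos
  obtain ⟨hA, hAlt⟩ := iInf_lt_iff.1 hAlt
  obtain ⟨-, -, -, a4, a5⟩ := hA
  refine a5.trans ((volume_smallSet_le_add (Y := Y) a4 s).trans ?_)
  gcongr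
  rw [mul_comm]
  exact ENNReal.mul_le_of_le_div hAlt.le

theorem lintegral_pi_insertNth {α : Type*} [MeasurableSpace α] {n : ℕ} (μ : Measure α)
    [SigmaFinite μ] (j : Fin (n + 1)) {f : (Fin (n + 1) → α) → ℝ≥0∞} (hf : Measurable f) :
    ∫⁻ x, f x ∂(Measure.pi fun _ => μ) =
      ∫⁻ y, ∫⁻ a, f (j.insertNth a y) ∂μ ∂(Measure.pi fun _ : Fin n => μ) := by
  have h := (measurePreserving_piFinSuccAbove (fun _ : Fin (n + 1) => μ) j).symm
  rw [← h.lintegral_comp hf]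
  exact lintegral_prod_symm' _
    (hf.comp (MeasurableEquiv.piFinSuccAbove (fun _ => α) j).symm.measurable)

theorem lintegral_pi_cons {α : Type*} [MeasurableSpace α] {n : ℕ} (μ : Measure α)
    [SigmaFinite μ] {f : (Fin (n + 1) → α) → ℝ≥0∞} (hf : Measurable f) :
    ∫⁻ x, f x ∂(Measure.pi fun _ => μ) =
      ∫⁻ y, ∫⁻ a, f (Fin.cons a y) ∂μ ∂(Measure.pi fun _ : Fin n => μ) := by
  simpa only [Fin.insertNth_zero'] using lintegral_pi_insertNth μ 0 hf

theorem lintegral_pi_cons_symm {α : Type*} [MeasurableSpace α] {n : ℕ} (μ : Measure α)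
    [SigmaFinite μ] {f : (Fin (n + 1) → α) → ℝ≥0∞} (hf : Measurable f) :
    ∫⁻ x, f x ∂(Measure.pi fun _ => μ) =
      ∫⁻ a, ∫⁻ y, f (Fin.cons a y) ∂(Measure.pi fun _ : Fin n => μ) ∂μ := by
  have h := (measurePreserving_piFinSuccAbove (fun _ : Fin (n + 1) => μ) 0).symm
  have h0 := lintegral_prod (μ := μ) (ν := Measure.pi fun _ : Fin n => μ) _
    (hf.comp (MeasurableEquiv.piFinSuccAbove (fun _ => α) 0).symm.measurable).aemeasurable
  rw [← h.lintegral_comp hf]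
  refine h0.trans (lintegral_congr fun a => lintegral_congr fun y => ?_)
  simp [Fin.consEquiv]

theorem measurePreserving_uncurry {a b : ℕ} (ν : Measure ℝ) [SigmaFinite ν] :
    MeasurePreserving (fun (Z : Fin a → Fin b → ℝ) (q : Fin a × Fin b) => Z q.1 q.2)
      (Measure.pi fun _ => Measure.pi fun _ => ν) (Measure.pi fun _ => ν) := by
  refine ⟨by fun_prop, (Measure.pi_eq fun s hs => ?_).symm⟩
  rw [Measure.map_apply (by fun_prop) (MeasurableSet.univ_pi hs)]
  have : (fun (Z : Fin a → Fin b → ℝ) (q : Fin a × Fin b) => Z q.1 q.2) ⁻¹' Set.univ.pi s =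
      Set.univ.pi fun i => Set.univ.pi fun j => s (i, j) := by
    ext Z; simp
  rw [this, Measure.pi_pi, Fintype.prod_prod_type]
  simp_rw [Measure.pi_pi]

theorem measurePreserving_swap_pi {a b : ℕ} (ν : Measure ℝ) [SigmaFinite ν] :
    MeasurePreserving (fun (Z : Fin a → Fin b → ℝ) j i => Z i j)
      (Measure.pi fun _ => Measure.pi fun _ => ν) (Measure.pi fun _ => Measure.pi fun _ => ν) := by
  have h1 := measurePreserving_uncurry (a := a) (b := b) ν
  have h2 : MeasurePreserving (fun (w : Fin a × Fin b → ℝ) (q : Fin b × Fin a) => w (q.2, q.1))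
      (Measure.pi fun _ => ν) (Measure.pi fun _ => ν) := by
    refine ⟨by fun_prop, (Measure.pi_eq fun s hs => ?_).symm⟩
    rw [Measure.map_apply (by fun_prop) (MeasurableSet.univ_pi hs)]
    have : (fun (w : Fin a × Fin b → ℝ) (q : Fin b × Fin a) => w (q.2, q.1)) ⁻¹' Set.univ.pi s =
        Set.univ.pi fun q => s (q.2, q.1) := by
      ext w
      simp only [Set.mem_preimage, Set.mem_univ_pi]
      exact ⟨fun h q => h (q.2, q.1), fun h q => h (q.2, q.1)⟩
    rw [this, Measure.pi_pi, Fintype.prod_prod_type, Fintype.prod_prod_type, Finset.prod_comm]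
  have h3 : MeasurePreserving (MeasurableEquiv.curry (Fin b) (Fin a) ℝ)
      (Measure.pi fun _ => ν) (Measure.pi fun _ => Measure.pi fun _ => ν) :=
    MeasurePreserving.symm (MeasurableEquiv.curry (Fin b) (Fin a) ℝ).symm
      (measurePreserving_uncurry (a := b) (b := a) ν)
  exact h3.comp (h2.comp h1)

theorem lintegral_linear_form_le {n : ℕ} (ν : Measure ℝ) [IsFiniteMeasure ν] {F : ℝ → ℝ≥0∞}
    (hF : Measurable F) (D : Fin (n + 1) → ℝ) (j : Fin (n + 1)) {A : ℝ≥0∞}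
    (h : ∀ e, ∫⁻ t, F (t * D j + e) ∂ν ≤ A) :
    ∫⁻ a, F (∑ i, a i * D i) ∂(Measure.pi fun _ => ν) ≤ A * ν Set.univ ^ n := by
  have hm : Measurable fun a : Fin (n + 1) → ℝ => F (∑ i, a i * D i) := hF.comp (by fun_prop)
  rw [lintegral_pi_insertNth ν j hm]
  simp only [Fin.sum_univ_succAbove _ j, Fin.insertNth_apply_same, Fin.insertNth_apply_succAbove]
  refine (lintegral_mono fun y => h _).trans ?_
  simp [Measure.pi_univ]

theorem lintegral_rpow_unit : ∫⁻ u in Set.Icc (-1 : ℝ) 1, ‖u‖ₑ ^ (-(1 / 2) : ℝ) < ∞ := by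
  have h : ∫⁻ u in Set.Ioo (0 : ℝ) 1, ‖u‖ₑ ^ (-(1 / 2) : ℝ) < ∞ := by
    have h1 : IntegrableOn (fun u : ℝ => u ^ (-(1 / 2) : ℝ)) (Set.Ioo 0 1) :=
      (intervalIntegral.integrableOn_Ioo_rpow_iff one_pos).2 (by norm_num)
    refine lt_of_eq_of_lt (setLIntegral_congr_fun measurableSet_Ioo fun u hu => ?_) h1.2
    simp only
    rw [← ofReal_norm, ← ofReal_norm, Real.norm_of_nonneg hu.1.le,
      Real.norm_of_nonneg (Real.rpow_nonneg hu.1.le _), ENNReal.ofReal_rpow_of_pos hu.1]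
  have h' : ∫⁻ u in Set.Ioo (-1 : ℝ) 0, ‖u‖ₑ ^ (-(1 / 2) : ℝ) < ∞ := by
    have e := (Measure.measurePreserving_neg (volume : Measure ℝ)).setLIntegral_comp_preimage
      (s := Set.Ioo (0 : ℝ) 1) measurableSet_Ioo
      (f := fun u => ‖u‖ₑ ^ (-(1 / 2) : ℝ)) (by fun_prop)
    simp only [enorm_neg] at e
    rw [← e] at h
    simpa using h
  have hsub : Set.Icc (-1 : ℝ) 1 ⊆ Set.Ioo (-1) 0 ∪ Set.Ioo 0 1 ∪ {-1, 0, 1} := by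
    intro u hu
    simp only [Set.mem_union, Set.mem_Ioo, Set.mem_insert_iff, Set.mem_singleton_iff]
    rcases lt_trichotomy u 0 with h | h | h
    · rcases hu.1.eq_or_lt with h' | h' <;> grind
    · grind
    · rcases hu.2.eq_or_lt with h' | h' <;> grind
  refine (lintegral_mono_set hsub).trans_lt ?_
  refine (lintegral_union_le _ _ _).trans_lt ?_
  rw [setLIntegral_measure_zero {-1, 0, 1} _ (Set.Finite.measure_zero (by simp) _), add_zero]
  exact (lintegral_union_le _ _ _).trans_lt (ENNReal.add_lt_top.2 ⟨h', h⟩)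

theorem exists_lintegral_affine_rpow_le (R : ℝ) : ∃ C : ℝ≥0∞, C ≠ ∞ ∧ ∀ c e : ℝ,
    ∫⁻ t in Set.Icc (-R) R, ‖t * c + e‖ₑ ^ (-(1 / 2) : ℝ) ≤ C * ‖c‖ₑ ^ (-(1 / 2) : ℝ) := by
  set A := ∫⁻ u in Set.Icc (-1 : ℝ) 1, ‖u‖ₑ ^ (-(1 / 2) : ℝ) with hA
  set f : ℝ → ℝ≥0∞ := fun u => ‖u‖ₑ ^ (-(1 / 2) : ℝ) with hf
  have hfm : Measurable f := by fun_prop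
  have hle : ∀ u, f u ≤ (Set.Icc (-1 : ℝ) 1).indicator f u + 1 := by
    intro u
    by_cases hu : u ∈ Set.Icc (-1 : ℝ) 1
    · rw [Set.indicator_of_mem hu]; exact le_self_add
    · rw [Set.indicator_of_notMem hu, zero_add]
      refine ENNReal.rpow_le_one_of_one_le_of_neg ?_ (by norm_num)
      rw [← ofReal_norm, ENNReal.one_le_ofReal, Real.norm_eq_abs]
      rw [Set.mem_Icc, ← abs_le] at hu
      linarith
  refine ⟨A + volume (Set.Icc (-R) R) + 1, ?_, fun c e => ?_⟩
  · exact ENNReal.add_ne_top.2 ⟨ENNReal.add_ne_top.2 ⟨lintegral_rpow_unit.ne,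
      measure_Icc_lt_top.ne⟩, ENNReal.one_ne_top⟩
  by_cases hc : c = 0
  · simp [hc, ENNReal.zero_rpow_of_neg, ENNReal.mul_top]
  · have h1 : ∀ t : ℝ, ‖t * c + e‖ₑ ^ (-(1 / 2) : ℝ) = f (t + e / c) * ‖c‖ₑ ^ (-(1 / 2) : ℝ) := by
      intro t
      rw [hf, ← ENNReal.mul_rpow_of_ne_top (by simp) (by simp), ← enorm_mul]
      congr 2
      field_simp
    simp_rw [h1]
    rw [lintegral_mul_const _ (by fun_prop)]
    gcongr
    calc ∫⁻ t in Set.Icc (-R) R, f (t + e / c)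
        ≤ ∫⁻ t in Set.Icc (-R) R, ((Set.Icc (-1 : ℝ) 1).indicator f (t + e / c) + 1) :=
          lintegral_mono fun t => hle _
      _ = (∫⁻ t in Set.Icc (-R) R, (Set.Icc (-1 : ℝ) 1).indicator f (t + e / c)) +
          volume (Set.Icc (-R) R) := by
          rw [lintegral_add_right _ measurable_const]; simp
      _ ≤ (∫⁻ t, (Set.Icc (-1 : ℝ) 1).indicator f (t + e / c)) + volume (Set.Icc (-R) R) := by
          gcongr; exact Measure.restrict_le_self
      _ = A + volume (Set.Icc (-R) R) := by
          rw [lintegral_add_right_eq_self (μ := volume) ((Set.Icc (-1 : ℝ) 1).indicator f) (e / c),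
            lintegral_indicator measurableSet_Icc]
      _ ≤ _ := le_self_add

theorem lintegral_affine_indicator_le (R : ℝ) {s : ℝ} (hs : 0 < s) (c e : ℝ) :
    ∫⁻ t in Set.Icc (-R) R, (Set.Icc (-s) s).indicator 1 (t * c + e) ≤
      ENNReal.ofReal (2 * s) * ‖c‖ₑ⁻¹ := by
  by_cases hc : c = 0
  · simp [hc, ENNReal.mul_top, hs]
  · have h1 : ∫⁻ t in Set.Icc (-R) R, (Set.Icc (-s) s).indicator 1 (t * c + e) ≤
        ∫⁻ t, (Set.Icc (-s) s).indicator 1 (t * c + e) :=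
      lintegral_mono' Measure.restrict_le_self le_rfl
    refine h1.trans (le_of_eq ?_)
    have h2 : ∀ t : ℝ, (Set.Icc (-s) s).indicator (1 : ℝ → ℝ≥0∞) (t * c + e) =
        ((fun t => t * c) ⁻¹' ((fun t => t + e) ⁻¹' Set.Icc (-s) s)).indicator 1 t := by
      intro t; rfl
    simp_rw [h2]
    rw [lintegral_indicator_one (by measurability), Real.volume_preimage_mul_right hc,
      measure_preimage_add_right, Real.volume_Icc, mul_comm, ← enorm_inv hc, ← ofReal_norm c⁻¹,
      Real.norm_eq_abs]
    congr 2; ring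

/-- The signed maximal minors of `m` vectors in `ℝ^(m+1)`. -/
noncomputable def minors {m : ℕ} (Y : Fin m → Fin (m + 1) → ℝ) : Fin (m + 1) → ℝ :=
  fun j => (-1) ^ (j : ℕ) * Matrix.det (Matrix.of fun i l => Y i (j.succAbove l))

@[fun_prop] theorem measurable_minors {m : ℕ} : Measurable (minors (m := m)) := by
  refine Continuous.measurable (continuous_pi fun j => continuous_const.mul ?_)
  refine Continuous.matrix_det (continuous_matrix fun i l => ?_)
  simp only [Matrix.of_apply]
  fun_prop

theorem det_cons_eq_sum_minors {m : ℕ} (a : Fin (m + 1) → ℝ) (Y : Fin m → Fin (m + 1) → ℝ) :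
    Matrix.det (Matrix.of (Fin.cons a Y : Fin (m + 1) → Fin (m + 1) → ℝ)) =
      ∑ j, a j * minors Y j := by
  rw [Matrix.det_succ_row_zero]
  refine Finset.sum_congr rfl fun j _ => ?_
  simp only [minors, Matrix.of_apply, Fin.cons_zero]
  have : (Matrix.of (Fin.cons a Y : Fin (m + 1) → Fin (m + 1) → ℝ)).submatrix Fin.succ
      j.succAbove = Matrix.of fun i l => Y i (j.succAbove l) := by
    ext i l; simp
  rw [this]; ring

theorem enorm_minors_transpose {m : ℕ} (Z : Fin (m + 1) → Fin m → ℝ) (j : Fin (m + 1)) :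
    ‖minors (fun i l => Z l i) j‖ₑ = ‖Matrix.det (Matrix.of fun l i => Z (j.succAbove l) i)‖ₑ := by
  rw [minors, enorm_mul, ← Matrix.det_transpose]
  have : ‖((-1 : ℝ)) ^ (j : ℕ)‖ₑ = 1 := by rw [enorm_pow]; simp
  rw [this, one_mul]
  rfl

theorem exists_enorm_eq_enorm {n : ℕ} (D : Fin (n + 1) → ℝ) : ∃ j, ‖D j‖ₑ = ‖D‖ₑ := by
  obtain ⟨j, -, hj⟩ := Finset.exists_mem_eq_sup' Finset.univ_nonempty fun i => ‖D i‖₊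
  refine ⟨j, ?_⟩
  rw [enorm_eq_nnnorm, enorm_eq_nnnorm, Pi.nnnorm_def, ← Finset.sup'_eq_sup Finset.univ_nonempty, hj]

theorem inv_enorm_minors_transpose_le {m : ℕ} (a b : Fin (m + 1) → ℝ)
    (Y : Fin m → Fin (m + 1) → ℝ) :
    ‖minors (fun i l => (Fin.cons a (Fin.cons b Y : Fin (m + 1) → Fin (m + 1) → ℝ) :
      Fin (m + 2) → Fin (m + 1) → ℝ) l i)‖ₑ⁻¹ ≤
      ‖∑ j, b j * minors Y j‖ₑ ^ (-(1 / 2) : ℝ) * ‖∑ j, a j * minors Y j‖ₑ ^ (-(1 / 2) : ℝ) := by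
  set Z : Fin (m + 2) → Fin (m + 1) → ℝ := Fin.cons a (Fin.cons b Y : Fin (m + 1) → _) with hZ
  set D := minors (fun i l => Z l i) with hD
  have hle : ∀ j, ‖D j‖ₑ ≤ ‖D‖ₑ := fun j => by
    rw [enorm_eq_nnnorm, enorm_eq_nnnorm]; exact_mod_cast nnnorm_le_pi_nnnorm D j
  have h0 : ‖∑ j, b j * minors Y j‖ₑ ≤ ‖D‖ₑ := by
    refine le_of_eq_of_le ?_ (hle 0)
    rw [hD, enorm_minors_transpose, ← det_cons_eq_sum_minors]
    congr 2
  have h1 : ‖∑ j, a j * minors Y j‖ₑ ≤ ‖D‖ₑ := by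
    refine le_of_eq_of_le ?_ (hle 1)
    rw [hD, enorm_minors_transpose, ← det_cons_eq_sum_minors]
    congr 2
    ext l i
    refine Fin.cases ?_ (fun l => ?_) l
    · simp [hZ]
    · have : (1 : Fin (m + 2)).succAbove l.succ = l.succ.succ := by
        rw [show (1 : Fin (m + 2)) = Fin.succ 0 from rfl, Fin.succ_succAbove_succ,
          Fin.zero_succAbove]
      simp [hZ, this]
  have hhalf : ‖D‖ₑ⁻¹ = ‖D‖ₑ ^ (-(1 / 2) : ℝ) * ‖D‖ₑ ^ (-(1 / 2) : ℝ) := by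
    rw [← sq, ← ENNReal.rpow_natCast, ← ENNReal.rpow_mul, ← ENNReal.rpow_neg_one]
    norm_num
  rw [hhalf]
  simp only [ENNReal.rpow_neg]
  gcongr

theorem lintegral_inv_minors_lt_top (R : ℝ) (m : ℕ) :
    ∫⁻ Y, ‖minors Y‖ₑ⁻¹ ∂(Measure.pi fun _ : Fin m => Measure.pi fun _ : Fin (m + 1) =>
      volume.restrict (Set.Icc (-R) R)) < ∞ := by
  set ν : Measure ℝ := volume.restrict (Set.Icc (-R) R) with hν
  have : IsFiniteMeasure ν := ⟨by simp [hν]⟩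
  induction m with
  | zero =>
    obtain h : ∀ Y : Fin 0 → Fin 1 → ℝ, ‖minors Y‖ₑ⁻¹ = 1 := by
      intro Y
      have : minors Y = fun _ => 1 := by ext j; simp [minors]
      rw [this]; simp [enorm_eq_nnnorm, Pi.nnnorm_def]
    simp only [h]
    simp
  | succ m ih =>
    obtain ⟨C, hC, hCle⟩ := exists_lintegral_affine_rpow_le R
    set M := ν Set.univ ^ m with hM
    have hMtop : M ≠ ∞ := ENNReal.pow_ne_top (measure_ne_top _ _)
    set g : (Fin (m + 1) → ℝ) → (Fin m → Fin (m + 1) → ℝ) → ℝ≥0∞ :=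
      fun a Y => ‖∑ j, a j * minors Y j‖ₑ ^ (-(1 / 2) : ℝ) with hg
    have hmin : ∀ j, Measurable fun Y : Fin m → Fin (m + 1) → ℝ => minors Y j :=
      fun j => (measurable_pi_apply j).comp measurable_minors
    have hgm : Measurable fun q : (Fin (m + 1) → ℝ) × (Fin m → Fin (m + 1) → ℝ) => g q.1 q.2 := by
      refine Measurable.pow_const (Measurable.enorm (Finset.measurable_sum _ fun j _ => ?_)) _
      exact ((measurable_pi_apply j).comp measurable_fst).mul ((hmin j).comp measurable_snd)
    have hga : ∀ Y, Measurable fun a => g a Y := fun Y => by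
      simp only [hg]
      fun_prop
    have hgle : ∀ Y, ∫⁻ a, g a Y ∂(Measure.pi fun _ => ν) ≤
        C * M * ‖minors Y‖ₑ ^ (-(1 / 2) : ℝ) := by
      intro Y
      obtain ⟨j, hj⟩ := exists_enorm_eq_enorm (minors Y)
      have := lintegral_linear_form_le ν (F := fun u => ‖u‖ₑ ^ (-(1 / 2) : ℝ)) (by fun_prop)
        (minors Y) j (fun e => hCle (minors Y j) e)
      rw [hj] at this
      exact this.trans (le_of_eq (by ring))
    have hinv : Measurable fun Y : Fin (m + 1) → Fin (m + 2) → ℝ => ‖minors Y‖ₑ⁻¹ :=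
      (measurable_minors.enorm).inv
    rw [← (measurePreserving_swap_pi (a := m + 2) (b := m + 1) ν).lintegral_comp hinv,
      lintegral_pi_cons _ (by fun_prop)]
    calc _ ≤ ∫⁻ W, ∫⁻ a, g (W 0) (Fin.tail W) * g a (Fin.tail W) ∂(Measure.pi fun _ => ν)
          ∂(Measure.pi fun _ : Fin (m + 1) => Measure.pi fun _ : Fin (m + 1) => ν) := by
          refine lintegral_mono fun W => lintegral_mono fun a => ?_
          have := inv_enorm_minors_transpose_le a (W 0) (Fin.tail W)
          rwa [Fin.cons_self_tail] at this
      _ ≤ ∫⁻ W, g (W 0) (Fin.tail W) * (C * M * ‖minors (Fin.tail W)‖ₑ ^ (-(1 / 2) : ℝ))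
          ∂(Measure.pi fun _ : Fin (m + 1) => Measure.pi fun _ : Fin (m + 1) => ν) := by
          refine lintegral_mono fun W => ?_
          rw [lintegral_const_mul _ (hga _)]
          gcongr
          exact hgle _
      _ = ∫⁻ Y, ∫⁻ b, g b Y * (C * M * ‖minors Y‖ₑ ^ (-(1 / 2) : ℝ)) ∂(Measure.pi fun _ => ν)
          ∂(Measure.pi fun _ : Fin m => Measure.pi fun _ : Fin (m + 1) => ν) := by
          have ht : Measurable fun W : Fin (m + 1) → Fin (m + 1) → ℝ => Fin.tail W :=
            measurable_pi_lambda _ fun i => measurable_pi_apply _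
          rw [lintegral_pi_cons _]
          · simp only [Fin.cons_zero, Fin.tail_cons]
          · exact (hgm.comp ((measurable_pi_apply 0).prodMk ht)).mul
              (measurable_const.mul ((measurable_minors.comp ht).enorm.pow_const _))
      _ ≤ ∫⁻ Y, (C * M) * (C * M) * ‖minors Y‖ₑ⁻¹
          ∂(Measure.pi fun _ : Fin m => Measure.pi fun _ : Fin (m + 1) => ν) := by
          refine lintegral_mono fun Y => ?_
          rw [lintegral_mul_const _ (hga _)]
          have hhalf : ‖minors Y‖ₑ⁻¹ =
              ‖minors Y‖ₑ ^ (-(1 / 2) : ℝ) * ‖minors Y‖ₑ ^ (-(1 / 2) : ℝ) := by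
            rw [← sq, ← ENNReal.rpow_natCast, ← ENNReal.rpow_mul, ← ENNReal.rpow_neg_one]
            norm_num
          rw [hhalf]
          refine (mul_le_mul' (hgle Y) le_rfl).trans (le_of_eq (by ring))
      _ < ∞ := by
          rw [lintegral_const_mul _ (by fun_prop)]
          exact ENNReal.mul_lt_top (by finiteness) ih

theorem exists_volume_det_le (R : ℝ) (m : ℕ) : ∃ C : ℝ≥0∞, C ≠ ∞ ∧ ∀ s : ℝ, 0 < s →
    (Measure.pi fun _ : Fin (m + 1) => Measure.pi fun _ : Fin (m + 1) =>
      (volume : Measure ℝ).restrict (Set.Icc (-R) R))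
      {Y | |Matrix.det (Matrix.of Y)| ≤ s} ≤ C * ENNReal.ofReal s := by
  set ν : Measure ℝ := volume.restrict (Set.Icc (-R) R) with hν
  have : IsFiniteMeasure ν := ⟨by simp [hν]⟩
  set H := ∫⁻ Y, ‖minors Y‖ₑ⁻¹ ∂(Measure.pi fun _ : Fin m => Measure.pi fun _ : Fin (m + 1) => ν)
    with hH
  have hHtop : H ≠ ∞ := (lintegral_inv_minors_lt_top R m).ne
  have hMtop : ν Set.univ ^ m ≠ ∞ := ENNReal.pow_ne_top (measure_ne_top _ _)
  refine ⟨2 * ν Set.univ ^ m * H, by finiteness, fun s hs => ?_⟩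
  have hdet : Measurable fun Y : Fin (m + 1) → Fin (m + 1) → ℝ => Matrix.det (Matrix.of Y) := by
    refine Continuous.measurable (Continuous.matrix_det (continuous_matrix fun i l => ?_))
    simp only [Matrix.of_apply]
    fun_prop
  have hF : Measurable ((Set.Icc (-s) s).indicator (1 : ℝ → ℝ≥0∞)) :=
    measurable_one.indicator measurableSet_Icc
  have hset : {Y : Fin (m + 1) → Fin (m + 1) → ℝ | |Matrix.det (Matrix.of Y)| ≤ s} =
      (fun Y => Matrix.det (Matrix.of Y)) ⁻¹' Set.Icc (-s) s := by
    ext Y; simp [abs_le]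
  rw [hset, ← lintegral_indicator_one (hdet measurableSet_Icc),
    lintegral_pi_cons _ (measurable_one.indicator (hdet measurableSet_Icc))]
  calc _ ≤ ∫⁻ Y, ENNReal.ofReal (2 * s) * ν Set.univ ^ m * ‖minors Y‖ₑ⁻¹
        ∂(Measure.pi fun _ : Fin m => Measure.pi fun _ : Fin (m + 1) => ν) := by
        refine lintegral_mono fun Y => ?_
        obtain ⟨j, hj⟩ := exists_enorm_eq_enorm (minors Y)
        have h := lintegral_linear_form_le ν hF (minors Y) j
          (fun e => lintegral_affine_indicator_le R hs (minors Y j) e)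
        rw [hj] at h
        simp_rw [← det_cons_eq_sum_minors] at h
        exact h.trans (le_of_eq (by ring))
    _ = _ := by
        rw [lintegral_const_mul _ (by fun_prop), ENNReal.ofReal_mul (by norm_num)]
        simp only [ENNReal.ofReal_ofNat]
        rw [← hH]
        ring

theorem exists_volume_smallSet_le {k : ℕ} {K : Set (Euc (k + 1))} (hc : IsCompact K) :
    ∃ C : ℝ≥0∞, C ≠ ∞ ∧ ∀ s : ℝ, 0 < s → volume (smallSet K s) ≤ C * ENNReal.ofReal s := by
  obtain ⟨R, hR⟩ := hc.isBounded.subset_closedBall 0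
  obtain ⟨C, hC, hle⟩ := exists_volume_det_le (2 * R) k
  refine ⟨C * volume K, ENNReal.mul_ne_top hC hc.measure_lt_top.ne, fun s hs => ?_⟩
  set ν : Measure ℝ := volume.restrict (Set.Icc (-(2 * R)) (2 * R)) with hν
  have hm := measurableSet_smallSet hc.measurableSet s
  have hone : Measurable ((smallSet K s).indicator (1 : (Fin (k + 2) → Euc (k + 1)) → ℝ≥0∞)) :=
    measurable_one.indicator hm
  set D : Set (Fin (k + 1) → Fin (k + 1) → ℝ) := {Y | |Matrix.det (Matrix.of Y)| ≤ s} with hD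
  have hDc : IsClosed D := by
    refine isClosed_le ?_ continuous_const
    refine (Continuous.matrix_det (continuous_matrix fun i l => ?_)).abs
    simp only [Matrix.of_apply]
    fun_prop
  have hcube : volume (D ∩ Set.univ.pi fun _ => Set.univ.pi fun _ => Set.Icc (-(2 * R)) (2 * R)) ≤
      C * ENNReal.ofReal s := by
    refine le_of_eq_of_le ?_ (hle s hs)
    rw [← Measure.restrict_apply hDc.measurableSet, volume_pi, Measure.restrict_pi_pi]
    simp_rw [volume_pi, Measure.restrict_pi_pi]
    rfl
  have hfix : ∀ a ∈ K, volume {y : Fin (k + 1) → Euc (k + 1) |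
      (Fin.cons a y : Fin (k + 2) → Euc (k + 1)) ∈ smallSet K s} ≤ C * ENNReal.ofReal s := by
    intro a ha
    have hmp : MeasurePreserving (fun (y : Fin (k + 1) → Euc (k + 1)) i => (y i - a).ofLp) :=
      volume_preserving_pi fun _ => (PiLp.volume_preserving_ofLp (Fin (k + 1))).comp
        (measurePreserving_sub_right volume a)
    have hmeas : MeasurableSet
        (D ∩ Set.univ.pi fun _ => Set.univ.pi fun _ => Set.Icc (-(2 * R)) (2 * R)) :=
      hDc.measurableSet.inter (MeasurableSet.univ_pi fun _ => MeasurableSet.univ_pi fun _ =>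
        measurableSet_Icc)
    rw [← hmp.measure_preimage hmeas.nullMeasurableSet] at hcube
    refine (measure_mono ?_).trans hcube
    rintro y ⟨hy, hys⟩
    refine ⟨hys, fun i _ j _ => ?_⟩
    have h1 : ‖y i‖ ≤ R := by simpa using hR (hy i.succ)
    have h2 : ‖a‖ ≤ R := by simpa using hR ha
    have h3 : ‖(y i - a) j‖ ≤ ‖y i - a‖ := PiLp.norm_apply_le _ _
    have h4 := norm_sub_le (y i) a
    rw [Set.mem_Icc, ← abs_le, ← Real.norm_eq_abs]
    linarith
  rw [← lintegral_indicator_one hm]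
  rw [volume_pi, lintegral_pi_cons_symm _ hone]
  calc _ ≤ ∫⁻ a, K.indicator (fun _ => C * ENNReal.ofReal s) a := by
        refine lintegral_mono fun a => ?_
        by_cases ha : a ∈ K
        · rw [Set.indicator_of_mem ha]
          refine le_of_eq_of_le ?_ (hfix a ha)
          have hcons : Measurable fun y : Fin (k + 1) → Euc (k + 1) =>
              (Fin.cons a y : Fin (k + 2) → Euc (k + 1)) :=
            (Continuous.finCons continuous_const continuous_id).measurable
          exact lintegral_indicator_one (hcons hm)
        · have h0 : ∀ y : Fin (k + 1) → Euc (k + 1), (smallSet K s).indicator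
              (1 : (Fin (k + 2) → Euc (k + 1)) → ℝ≥0∞) (Fin.cons a y) = 0 :=
            fun y => Set.indicator_of_notMem (fun hy => ha (hy.1 0)) _
          simp [h0]
    _ = _ := by
        rw [lintegral_indicator hc.measurableSet, setLIntegral_const]; ring

theorem volume_smallSet_zero {k : ℕ} {K : Set (Euc (k + 1))} (hc : IsCompact K) :
    volume (smallSet K 0) = 0 := by
  obtain ⟨C, hC, hle⟩ := exists_volume_smallSet_le hc
  have h : Tendsto (fun s : ℝ => C * ENNReal.ofReal s) (nhdsWithin 0 (Set.Ioi 0)) (nhds 0) := by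
    have h1 : Tendsto (fun s : ℝ => C * ENNReal.ofReal s) (nhds 0)
        (nhds (C * ENNReal.ofReal 0)) :=
      ENNReal.Tendsto.const_mul (ENNReal.tendsto_ofReal tendsto_id) (Or.inr hC)
    simp only [ENNReal.ofReal_zero, mul_zero] at h1
    exact h1.mono_left nhdsWithin_le_nhds
  refine le_antisymm (ge_of_tendsto h ?_) zero_le
  filter_upwards [self_mem_nhdsWithin] with s hs
  refine (measure_mono ?_).trans (hle s hs)
  exact fun x hx => ⟨hx.1, hx.2.trans (le_of_lt hs)⟩

theorem subadditive_mul_le {f : ℝ → ℝ} (hm : Monotone f) (h0 : ∀ s, 0 ≤ f s)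
    (hadd : ∀ a b, f (a + b) ≤ f a + f b) {s₀ s : ℝ} (hs₀ : 0 < s₀) (hs : 0 < s) :
    f s₀ * s ≤ (s₀ + s) * f s := by
  have hmul : ∀ n : ℕ, 1 ≤ n → f (n * s) ≤ n * f s := by
    intro n hn
    induction n, hn using Nat.le_induction with
    | base => simp
    | succ n hn ih =>
      have h := hadd (n * s) s
      have e : ((n + 1 : ℕ) : ℝ) * s = n * s + s := by push_cast; ring
      rw [e]
      push_cast
      linarith
  have hpos : 0 < s₀ / s := by positivity
  have h1 : f s₀ ≤ ⌈s₀ / s⌉₊ * f s := by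
    refine le_trans (hm ?_) (hmul _ (Nat.ceil_pos.2 hpos))
    calc s₀ = s₀ / s * s := by field_simp
      _ ≤ _ := by gcongr; exact Nat.le_ceil _
  have h2 : f s₀ ≤ (s₀ / s + 1) * f s :=
    h1.trans (mul_le_mul_of_nonneg_right (Nat.ceil_lt_add_one hpos.le).le (h0 s))
  calc f s₀ * s ≤ (s₀ / s + 1) * f s * s := by gcongr
    _ = (s₀ + s) * f s := by field_simp

theorem exists_tendsto_div_of_subadditive {f : ℝ → ℝ} (hm : Monotone f) (h0 : ∀ s, 0 ≤ f s)
    (hadd : ∀ a b, f (a + b) ≤ f a + f b) {C : ℝ} (hC : ∀ s, 0 < s → f s ≤ C * s) :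
    ∃ g, Tendsto (fun s => f s / s) (nhdsWithin 0 (Set.Ioi 0)) (nhds g) := by
  set A : Set ℝ := (fun s => f s / s) '' Set.Ioi 0 with hA
  have hbdd : BddAbove A := by
    refine ⟨C, ?_⟩
    rintro _ ⟨s, hs, rfl⟩
    exact (div_le_iff₀ hs).2 (hC s hs)
  have hne : A.Nonempty := ⟨_, 1, by simp, rfl⟩
  refine ⟨sSup A, tendsto_order.2 ⟨fun a ha => ?_, fun a ha => ?_⟩⟩
  · obtain ⟨_, ⟨s₀, hs₀, rfl⟩, h⟩ := exists_lt_of_lt_csSup hne ha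
    rw [Set.mem_Ioi] at hs₀
    have hlim : Tendsto (fun s => f s₀ / (s₀ + s)) (nhdsWithin 0 (Set.Ioi 0))
        (nhds (f s₀ / (s₀ + 0))) := by
      refine Tendsto.mono_left ?_ nhdsWithin_le_nhds
      exact tendsto_const_nhds.div (tendsto_const_nhds.add tendsto_id) (by simpa using hs₀.ne')
    rw [add_zero] at hlim
    filter_upwards [hlim.eventually_const_lt h, self_mem_nhdsWithin] with s h1 hs
    rw [Set.mem_Ioi] at hs
    refine h1.trans_le ?_
    rw [div_le_div_iff₀ (by linarith) hs]
    linarith [subadditive_mul_le hm h0 hadd hs₀ hs]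
  · filter_upwards [self_mem_nhdsWithin] with s hs
    exact (le_csSup hbdd ⟨s, hs, rfl⟩).trans_lt ha

theorem integral_pow_mul_one_sub (n : ℕ) :
    ∫ t in (0 : ℝ)..1, (n + 1 : ℝ) * t ^ n * (1 - t) = 1 / (n + 2) := by
  have h : ∀ t : ℝ, (n + 1) * t ^ n * (1 - t) = (n + 1) * t ^ n - (n + 1) * t ^ (n + 1) := by
    intro t; ring
  simp_rw [h]
  rw [intervalIntegral.integral_sub (Continuous.intervalIntegrable (by fun_prop) _ _)
      (Continuous.intervalIntegrable (by fun_prop) _ _),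
    intervalIntegral.integral_const_mul, intervalIntegral.integral_const_mul, integral_pow,
    integral_pow]
  push_cast
  field_simp
  simp
  ring

theorem integral_pow_mul_one_sub_sq (n : ℕ) :
    ∫ t in (0 : ℝ)..1, (n + 1 : ℝ) * t ^ n * (1 - t) ^ 2 = (2 : ℝ) / (((n : ℝ) + 2) * ((n : ℝ) + 3)) := by
  have h : ∀ t : ℝ, (n + 1) * t ^ n * (1 - t) ^ 2 =
      (n + 1) * t ^ n - 2 * (n + 1) * t ^ (n + 1) + (n + 1) * t ^ (n + 2) := by
    intro t; ring
  simp_rw [h]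
  rw [intervalIntegral.integral_add (Continuous.intervalIntegrable (by fun_prop) _ _)
      (Continuous.intervalIntegrable (by fun_prop) _ _),
    intervalIntegral.integral_sub (Continuous.intervalIntegrable (by fun_prop) _ _)
      (Continuous.intervalIntegrable (by fun_prop) _ _),
    intervalIntegral.integral_const_mul, intervalIntegral.integral_const_mul,
    intervalIntegral.integral_const_mul, integral_pow, integral_pow, integral_pow]
  push_cast
  field_simp
  simp
  ring

theorem integral_pow_eq_integral_meas {X : Type*} [MeasurableSpace X] (μ : Measure X)
    [IsProbabilityMeasure μ] {U : X → ℝ} (hU : Measurable U) (h0 : ∀ᵐ x ∂μ, 0 ≤ U x)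
    (h1 : ∀ᵐ x ∂μ, U x ≤ 1) (n : ℕ) :
    ∫ x, U x ^ (n + 1) ∂μ = ∫ t in (0 : ℝ)..1, (n + 1) * t ^ n * μ.real {x | t ≤ U x} := by
  have hanti : Antitone fun t => μ.real {x | t ≤ U x} := fun s t hst =>
    measureReal_mono fun x hx => hst.trans hx
  have hpow : ∀ x : ℝ, ∫ t in (0 : ℝ)..x, (n + 1) * t ^ n = x ^ (n + 1) := by
    intro x
    rw [intervalIntegral.integral_const_mul, integral_pow]
    field_simp
    simp
  have hlc := lintegral_comp_eq_lintegral_meas_le_mul μ h0 hU.aemeasurable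
    (g := fun t => (n + 1) * t ^ n) (fun t _ => Continuous.intervalIntegrable (by fun_prop) _ _)
    ((ae_restrict_mem measurableSet_Ioi).mono fun t ht => by
      have : (0 : ℝ) < t := ht
      positivity)
  simp only [hpow] at hlc
  rw [integral_eq_lintegral_of_nonneg_ae (h0.mono fun x hx => pow_nonneg hx _)
    (hU.pow_const _).aestronglyMeasurable, hlc, intervalIntegral.integral_of_le zero_le_one,
    integral_eq_lintegral_of_nonneg_ae]
  · congr 1
    rw [← Set.Ioc_union_Ioi_eq_Ioi (zero_le_one (α := ℝ)),
      lintegral_union measurableSet_Ioi (Set.disjoint_left.2 fun t h h' => h.2.not_gt h')]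
    have hz : ∫⁻ t in Set.Ioi (1 : ℝ), μ {x | t ≤ U x} * ENNReal.ofReal ((n + 1) * t ^ n) = 0 := by
      rw [setLIntegral_congr_fun (g := fun _ => 0) measurableSet_Ioi, lintegral_zero]
      intro t ht
      have : μ {x | t ≤ U x} = 0 := by
        rw [measure_eq_zero_iff_ae_notMem]
        filter_upwards [h1] with x hx hx'
        exact (lt_of_lt_of_le ht hx').not_ge hx
      simp [this]
    rw [hz, add_zero]
    refine setLIntegral_congr_fun measurableSet_Ioc fun t ht => ?_
    have : 0 < t := ht.1
    rw [mul_comm, ENNReal.ofReal_mul (p := (n + 1) * t ^ n) (by positivity), ofReal_measureReal]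
  · filter_upwards [ae_restrict_mem measurableSet_Ioc] with t ht
    have : 0 < t := ht.1
    simp only [Pi.zero_apply]
    positivity
  · exact ((measurable_const.mul (measurable_id.pow_const n)).mul
      hanti.measurable).aestronglyMeasurable

theorem exists_abs_sub_le {F : ℝ → ℝ} {g : ℝ} (hz : F 0 = 0) (h0 : ∀ s, 0 ≤ F s)
    (h1 : ∀ s, F s ≤ 1) (hg : Tendsto (fun s => F s / s) (nhdsWithin 0 (Set.Ioi 0)) (nhds g))
    {ε : ℝ} (hε : 0 < ε) :
    ∃ M, 0 ≤ M ∧ ∀ s ∈ Set.Icc (0 : ℝ) 1, |F s - g * s| ≤ ε * s + M * s ^ 2 := by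
  obtain ⟨δ, hδ, hball⟩ := Metric.mem_nhdsWithin_iff.1
    (hg.eventually (Metric.ball_mem_nhds g hε))
  refine ⟨(1 + |g|) / δ ^ 2, by positivity, fun s hs => ?_⟩
  rcases hs.1.eq_or_lt with h | hs0
  · simp [← h, hz]
  by_cases hsδ : s < δ
  · have h := hball ⟨by simpa [abs_of_pos hs0] using hsδ, hs0⟩
    simp only [Set.mem_ofPred_eq, Real.dist_eq] at h
    have e : F s - g * s = (F s / s - g) * s := by field_simp
    rw [e, abs_mul, abs_of_pos hs0]
    have : 0 ≤ (1 + |g|) / δ ^ 2 * s ^ 2 := by positivity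
    nlinarith
  · push Not at hsδ
    have h2 : |F s - g * s| ≤ 1 + |g| := by
      refine (abs_sub _ _).trans ?_
      rw [abs_mul, abs_of_nonneg (h0 s), abs_of_pos hs0]
      nlinarith [h1 s, hs.2, abs_nonneg g]
    have h3 : 1 + |g| ≤ (1 + |g|) / δ ^ 2 * s ^ 2 := by
      rw [div_mul_eq_mul_div, le_div_iff₀ (by positivity)]
      gcongr
    have : 0 ≤ ε * s := by positivity
    linarith

/-- If `V` is small with probability asymptotic to `g s`, then `n` times the expectation of
`(1 - V) ^ n` tends to `g`. -/
theorem tendsto_mul_integral_one_sub_pow {X : Type*} [MeasurableSpace X] (μ : Measure X)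
    [IsProbabilityMeasure μ] {V : X → ℝ} (hV : Measurable V) (h0 : ∀ᵐ x ∂μ, 0 ≤ V x)
    (h1 : ∀ᵐ x ∂μ, V x ≤ 1) {g : ℝ} (hz : μ.real {x | V x ≤ 0} = 0)
    (hg : Tendsto (fun s => μ.real {x | V x ≤ s} / s) (nhdsWithin 0 (Set.Ioi 0)) (nhds g)) :
    Tendsto (fun n : ℕ => (n : ℝ) * ∫ x, (1 - V x) ^ n ∂μ) atTop (nhds g) := by
  set F : ℝ → ℝ := fun s => μ.real {x | V x ≤ s} with hF
  have hmono : Monotone F := fun s t hst => measureReal_mono fun x hx => le_trans hx hst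
  have hlc : ∀ n : ℕ, ∫ x, (1 - V x) ^ (n + 1) ∂μ =
      ∫ t in (0 : ℝ)..1, (n + 1) * t ^ n * F (1 - t) := by
    intro n
    rw [integral_pow_eq_integral_meas μ (U := fun x => 1 - V x) (by fun_prop)
      (h1.mono fun x hx => by linarith) (h0.mono fun x hx => by linarith)]
    simp only [hF, le_sub_comm]
  have hInt : ∀ n : ℕ, IntervalIntegrable (fun t : ℝ => (n + 1) * t ^ n * F (1 - t)) volume 0 1 := by
    intro n
    have ha : Antitone fun t => F (1 - t) := fun s t hst => hmono (by linarith)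
    exact ha.intervalIntegrable.continuousOn_mul (by fun_prop)
  have hbound : ∀ ε > 0, ∃ M, 0 ≤ M ∧ ∀ n : ℕ,
      |(∫ x, (1 - V x) ^ (n + 1) ∂μ) - g * (1 / (n + 2))| ≤
        ε * (1 / (n + 2)) + M * (2 / ((n + 2) * (n + 3))) := by
    intro ε hε
    obtain ⟨M, hM0, hM⟩ := exists_abs_sub_le hz (fun s => measureReal_nonneg)
      (fun s => measureReal_le_one) hg hε
    refine ⟨M, hM0, fun n => ?_⟩
    have e1 : (∫ x, (1 - V x) ^ (n + 1) ∂μ) - g * (1 / (n + 2)) =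
        ∫ t in (0 : ℝ)..1, (n + 1) * t ^ n * (F (1 - t) - g * (1 - t)) := by
      rw [hlc, ← integral_pow_mul_one_sub, ← intervalIntegral.integral_const_mul,
        ← intervalIntegral.integral_sub (hInt n)
          (Continuous.intervalIntegrable (by fun_prop) _ _)]
      congr 1
      ext t; ring
    have e2 : ε * (1 / (n + 2)) + M * (2 / ((n + 2) * (n + 3))) =
        ∫ t in (0 : ℝ)..1, (n + 1) * t ^ n * (ε * (1 - t) + M * (1 - t) ^ 2) := by
      rw [← integral_pow_mul_one_sub, ← integral_pow_mul_one_sub_sq,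
        ← intervalIntegral.integral_const_mul, ← intervalIntegral.integral_const_mul,
        ← intervalIntegral.integral_add (Continuous.intervalIntegrable (by fun_prop) _ _)
      (Continuous.intervalIntegrable (by fun_prop) _ _)]
      congr 1
      ext t; ring
    rw [e1, e2, ← Real.norm_eq_abs]
    refine intervalIntegral.norm_integral_le_of_norm_le zero_le_one
      (Eventually.of_forall fun t ht => ?_)
      (Continuous.intervalIntegrable (by fun_prop) _ _)
    have ht0 : 0 < t := ht.1
    rw [norm_mul, Real.norm_of_nonneg (by positivity), Real.norm_eq_abs]
    gcongr
    exact hM (1 - t) ⟨by linarith [ht.2], by linarith⟩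
  rw [← tendsto_add_atTop_iff_nat 1]
  have hw : Tendsto (fun n : ℕ => ((n : ℝ) + 1) / (n + 2)) atTop (nhds 1) := by
    have h := tendsto_one_div_add_atTop_nhds_zero_nat (𝕜 := ℝ)
    have h2 : Tendsto (fun n : ℕ => 1 - 1 / (((n + 1 : ℕ) : ℝ) + 1)) atTop (nhds (1 - 0)) :=
      tendsto_const_nhds.sub (h.comp (tendsto_add_atTop_nat 1))
    rw [sub_zero] at h2
    refine h2.congr fun n => ?_
    push_cast
    field_simp
    ring
  have hdiff : Tendsto (fun n : ℕ => ((n : ℝ) + 1) * ((∫ x, (1 - V x) ^ (n + 1) ∂μ) -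
      g * (1 / (n + 2)))) atTop (nhds 0) := by
    rw [Metric.tendsto_atTop']
    intro ε hε
    obtain ⟨M, hM0, hM⟩ := hbound (ε / 2) (by linarith)
    have hsmall : Tendsto (fun n : ℕ => 2 * M * (1 / ((n : ℝ) + 1))) atTop (nhds (2 * M * 0)) :=
      tendsto_const_nhds.mul tendsto_one_div_add_atTop_nhds_zero_nat
    rw [mul_zero] at hsmall
    obtain ⟨N, hN⟩ := eventually_atTop.1 (hsmall.eventually_lt_const (show 0 < ε / 2 by linarith))
    refine ⟨N, fun n hn => ?_⟩
    rw [Real.dist_eq, sub_zero, abs_mul, abs_of_nonneg (by positivity)]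
    calc ((n : ℝ) + 1) * |(∫ x, (1 - V x) ^ (n + 1) ∂μ) - g * (1 / (n + 2))|
        ≤ ((n : ℝ) + 1) * (ε / 2 * (1 / (n + 2)) + M * (2 / ((n + 2) * (n + 3)))) := by
          gcongr; exact hM n
      _ = ε / 2 * ((n + 1) / (n + 2)) + 2 * M * ((n + 1) / ((n + 2) * (n + 3))) := by ring
      _ ≤ ε / 2 * 1 + 2 * M * (1 / ((n : ℝ) + 1)) := by
          refine add_le_add (mul_le_mul_of_nonneg_left ?_ (by positivity))
            (mul_le_mul_of_nonneg_left ?_ (by positivity))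
          · rw [div_le_one (by positivity)]; linarith
          · rw [div_le_div_iff₀ (by positivity) (by positivity)]
            have : (0 : ℝ) ≤ n := by positivity
            nlinarith
      _ < ε := by linarith [hN n hn.le]
  have hsum := (hw.const_mul g).add hdiff
  rw [mul_one, add_zero] at hsum
  refine hsum.congr fun n => ?_
  push_cast
  ring

theorem affineIndependent_iff_edgeDet_ne_zero {d : ℕ} {z : Fin (d + 1) → Euc d} :
    AffineIndependent ℝ z ↔ edgeDet z ≠ 0 := by
  rw [affineIndependent_iff_linearIndependent_vsub ℝ z 0,
    ← linearIndependent_equiv (finSuccAboveEquiv (0 : Fin (d + 1))),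
    ← LinearMap.linearIndependent_iff (WithLp.linearEquiv 2 ℝ (Fin d → ℝ)).toLinearMap
      (LinearEquiv.ker _)]
  have e : ⇑(WithLp.linearEquiv 2 ℝ (Fin d → ℝ)).toLinearMap ∘
      (fun i : {i // i ≠ (0 : Fin (d + 1))} => z i -ᵥ z 0) ∘ ⇑(finSuccAboveEquiv 0) =
      (Matrix.of fun i j : Fin d => z i.succ j - z 0 j).row := by
    ext i j
    simp [Matrix.row, finSuccAboveEquiv_apply]
  rw [e]
  refine Matrix.linearIndependent_rows_iff_isUnit.trans ?_
  rw [Matrix.isUnit_iff_isUnit_det, isUnit_iff_ne_zero]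
  rfl

theorem AffineIndependent.span_range_eq_top {d : ℕ} {z : Fin (d + 1) → Euc d}
    (h : AffineIndependent ℝ z) : affineSpan ℝ (Set.range z) = ⊤ :=
  h.affineSpan_eq_top_iff_card_eq_finrank_add_one.2 (by simp)

theorem AffineIndependent.notMem_interior_convexHull {d : ℕ} {z : Fin (d + 2) → Euc (d + 1)}
    (h : AffineIndependent ℝ z) (i : Fin (d + 2)) :
    z i ∉ interior (convexHull ℝ (Set.range z)) := by
  let b : AffineBasis (Fin (d + 2)) ℝ (Euc (d + 1)) := ⟨z, h, h.span_range_eq_top⟩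
  have hb := b.interior_convexHull
  intro hi
  change z i ∈ interior (convexHull ℝ (Set.range b)) at hi
  rw [hb] at hi
  obtain ⟨j, hj⟩ := exists_ne i
  have h0 : b.coord j (b i) = 0 := b.coord_apply_ne hj
  exact (hi j).ne' h0

theorem AffineIndependent.mem_interior_convexHull {d : ℕ} {z : Fin (d + 1) → Euc d}
    (h : AffineIndependent ℝ z) {y : Euc d} (hy : y ∈ convexHull ℝ (Set.range z))
    (hu : ∀ i, AffineIndependent ℝ (Function.update z i y)) :
    y ∈ interior (convexHull ℝ (Set.range z)) := by
  let b : AffineBasis (Fin (d + 1)) ℝ (Euc d) := ⟨z, h, h.span_range_eq_top⟩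
  change y ∈ convexHull ℝ (Set.range b) at hy
  change y ∈ interior (convexHull ℝ (Set.range b))
  rw [b.convexHull_eq_nonneg_coord] at hy
  rw [b.interior_convexHull]
  intro i
  refine lt_of_le_of_ne (hy i) fun h0 => ?_
  have hz : b.coord i = AffineMap.const ℝ (Euc d) (0 : ℝ) := by
    refine AffineMap.ext_on (hu i).span_range_eq_top ?_
    rintro _ ⟨j, rfl⟩
    by_cases hj : j = i
    · subst hj; simp [← h0]
    · have : b.coord i (b j) = 0 := b.coord_apply_ne (Ne.symm hj)
      rw [Function.update_of_ne hj]
      exact this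
  have h1 : b.coord i (b i) = 1 := b.coord_apply_eq i
  rw [hz] at h1
  simp at h1

theorem inConvexPosition_range {d : ℕ} {z : Fin (d + 1) → Euc d}
    (h : AffineIndependent ℝ z) : InConvexPosition (Set.range z) := by
  rintro _ ⟨i, rfl⟩ hi
  have := h.notMem_affineSpan_sdiff i Set.univ
  apply this
  refine affineSpan_mono ℝ ?_ (convexHull_subset_affineSpan _ hi)
  rintro _ ⟨⟨j, rfl⟩, hj⟩
  exact ⟨j, ⟨trivial, fun e => hj (congrArg z e)⟩, rfl⟩

/-- A finite family of points all of whose `(d + 1)`-element subfamilies are affinely independent. -/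
def FullyIndependent {d n : ℕ} (x : Fin n → Euc d) : Prop :=
  ∀ f : Fin (d + 1) → Fin n, Function.Injective f → AffineIndependent ℝ (x ∘ f)

theorem exists_injective_range_eq {m n : ℕ} {I : Finset (Fin n)} (hI : I.card = m) :
    ∃ f : Fin m → Fin n, Function.Injective f ∧ Set.range f = I :=
  ⟨I.orderEmbOfFin hI, (I.orderEmbOfFin hI).injective, I.range_orderEmbOfFin hI⟩

theorem FullyIndependent.injective {d n : ℕ} {x : Fin n → Euc (d + 1)} (h : FullyIndependent x)
    (hn : d + 2 ≤ n) : Function.Injective x := by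
  intro i j hij
  obtain ⟨I, h1, -, h2⟩ := Finset.exists_subsuperset_card_eq
    (Finset.subset_univ ({i, j} : Finset (Fin n)))
    (n := d + 2) (Finset.card_le_two.trans (by omega)) (by simpa using hn)
  obtain ⟨f, hf, hr⟩ := exists_injective_range_eq h2
  have hi : i ∈ Set.range f := by rw [hr]; exact h1 (by simp)
  have hj : j ∈ Set.range f := by rw [hr]; exact h1 (by simp)
  obtain ⟨a, rfl⟩ := hi
  obtain ⟨b, rfl⟩ := hj
  rw [(h f hf).injective hij]

open Classical in
theorem FullyIndependent.holeCount_eq {d n : ℕ} {x : Fin n → Euc (d + 1)}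
    (h : FullyIndependent x) (hn : d + 2 ≤ n) :
    holeCount (d + 1) (d + 2) n x = ((Finset.powersetCard (d + 2) Finset.univ).filter
      fun I : Finset (Fin n) => ∀ j ∉ I, x j ∉ convexHull ℝ (x '' I)).card := by
  have hx := h.injective hn
  have key : ∀ I : Finset (Fin n), I.card = d + 2 →
      (IsHole (d + 2) (Finset.image x Finset.univ) (I.image x) ↔
        ∀ j ∉ I, x j ∉ convexHull ℝ (x '' I)) := by
    intro I hI
    obtain ⟨f, hf, hr⟩ := exists_injective_range_eq hI
    have hz := h f hf
    have e : x '' I = Set.range (x ∘ f) := by rw [← hr, Set.range_comp]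
    simp only [IsHole, Finset.coe_image, e]
    constructor
    · rintro ⟨-, -, -, h4⟩ j hj hc
      refine h4 (x j) (by simp) (hz.mem_interior_convexHull hc fun i => ?_)
      rw [← Function.comp_update]
      refine h _ ?_
      have hj' : ∀ a, f a ≠ j := fun a ha => hj (by rw [← Finset.mem_coe, ← hr]; exact ⟨a, ha⟩)
      intro a c hac
      by_cases ha : a = i <;> by_cases hc' : c = i <;>
        simp_all [Function.update_apply, eq_comm, hf.eq_iff]
    · intro h1
      refine ⟨Finset.image_subset_image (Finset.subset_univ _), ?_, inConvexPosition_range hz, ?_⟩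
      · rw [Finset.card_image_of_injective _ hx, hI]
      · intro p hp
        obtain ⟨j, -, rfl⟩ := Finset.mem_image.1 hp
        by_cases hj : j ∈ I
        · have : j ∈ Set.range f := by rw [hr]; exact hj
          obtain ⟨a, rfl⟩ := this
          exact hz.notMem_interior_convexHull a
        · exact fun hc => h1 j hj (interior_subset hc)
  symm
  refine Finset.card_bij (fun I _ => I.image x) ?_ ?_ ?_
  · intro I hI
    rw [Finset.mem_filter, Finset.mem_powersetCard_univ] at hI
    rw [Finset.mem_filter, Finset.mem_powerset]
    exact ⟨Finset.image_subset_image (Finset.subset_univ _), (key I hI.1).2 hI.2⟩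
  · intro I _ J _ hIJ
    exact Finset.image_injective hx hIJ
  · intro H hH
    rw [Finset.mem_filter, Finset.mem_powerset] at hH
    obtain ⟨I, -, rfl⟩ := Finset.subset_image_iff.1 hH.1
    have hI : I.card = d + 2 := by
      rw [← hH.2.2.1, Finset.card_image_of_injective _ hx]
    refine ⟨I, ?_, rfl⟩
    rw [Finset.mem_filter, Finset.mem_powersetCard_univ]
    exact ⟨hI, (key I hI).1 hH.2⟩

theorem measurePreserving_splitRange {α : Type*} [MeasurableSpace α] (μ : Measure α)
    [SigmaFinite μ] {m n : ℕ} {f : Fin m → Fin n} (hf : Function.Injective f) :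
    MeasurePreserving (fun x : Fin n → α =>
        ((fun i => x (f i), fun j => x j) : (Fin m → α) × ({j // j ∉ Set.range f} → α)))
      (Measure.pi fun _ => μ) ((Measure.pi fun _ => μ).prod (Measure.pi fun _ => μ)) := by
  classical
  let e : Fin m ⊕ {j // j ∉ Set.range f} ≃ Fin n :=
    ((Equiv.ofInjective f hf).sumCongr (Equiv.refl _)).trans
      (Equiv.sumCompl (fun j => j ∈ Set.range f))
  have h1 := (measurePreserving_piCongrLeft (fun _ : Fin n => μ) e).symm
  have h2 := measurePreserving_sumPiEquivProdPi
    (fun _ : Fin m ⊕ {j // j ∉ Set.range f} => μ)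
  exact h2.comp h1

theorem measurePreserving_comp_injective {α : Type*} [MeasurableSpace α] (μ : Measure α)
    [IsProbabilityMeasure μ] {m n : ℕ} {f : Fin m → Fin n} (hf : Function.Injective f) :
    MeasurePreserving (fun (x : Fin n → α) i => x (f i))
      (Measure.pi fun _ => μ) (Measure.pi fun _ => μ) :=
  measurePreserving_fst.comp (measurePreserving_splitRange μ hf)

theorem measure_pi_forall_notMem_range {α : Type*} [MeasurableSpace α] (μ : Measure α)
    [IsProbabilityMeasure μ] {m n : ℕ} {f : Fin m → Fin n} (hf : Function.Injective f)
    {A : Set ((Fin m → α) × α)} (hA : MeasurableSet A) :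
    (Measure.pi fun _ => μ) {x : Fin n → α | ∀ j ∉ Set.range f, (fun i => x (f i), x j) ∈ A} =
      ∫⁻ z, μ {y | (z, y) ∈ A} ^ (n - m) ∂(Measure.pi fun _ : Fin m => μ) := by
  have hm : MeasurableSet {w : (Fin m → α) × ({j // j ∉ Set.range f} → α) |
      ∀ j, (w.1, w.2 j) ∈ A} := by
    simp only [Set.ofPred_forall]
    exact MeasurableSet.iInter fun j =>
      (measurable_fst.prodMk ((measurable_pi_apply j).comp measurable_snd)) hA
  have h := (measurePreserving_splitRange μ hf).measure_preimage hm.nullMeasurableSet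
  have e : {x : Fin n → α | ∀ j ∉ Set.range f, (fun i => x (f i), x j) ∈ A} =
      (fun x : Fin n → α =>
        ((fun i => x (f i), fun j => x j) : (Fin m → α) × ({j // j ∉ Set.range f} → α))) ⁻¹'
        {w | ∀ j, (w.1, w.2 j) ∈ A} := by
    ext x; simp
  rw [e, h, Measure.prod_apply hm]
  refine lintegral_congr fun z => ?_
  have e2 : Prod.mk z ⁻¹' {w : (Fin m → α) × ({j // j ∉ Set.range f} → α) |
      ∀ j, (w.1, w.2 j) ∈ A} = Set.univ.pi fun _ => {y | (z, y) ∈ A} := by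
    ext y; simp
  rw [e2, Measure.pi_pi, Finset.prod_const, Finset.card_univ]
  congr 1
  rw [Fintype.card_subtype_compl, Fintype.card_fin]
  congr 1
  exact (Set.card_range_of_injective hf).trans (Fintype.card_fin m)

theorem mem_convexHull_range_iff {ι : Type*} [Fintype ι] {E : Type*} [AddCommGroup E] [Module ℝ E]
    {z : ι → E} {y : E} :
    y ∈ convexHull ℝ (Set.range z) ↔ ∃ w ∈ stdSimplex ℝ ι, ∑ i, w i • z i = y := by
  classical
  have h : convexHull ℝ (Set.range z) = Fintype.linearCombination ℝ z '' stdSimplex ℝ ι := by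
    rw [← convexHull_basis_eq_stdSimplex, LinearMap.image_convexHull, ← Set.range_comp]
    congr 2
    ext i
    simp [Fintype.linearCombination_apply]
  rw [h]
  rfl

theorem isClosed_mem_convexHull_range {ι : Type*} [Fintype ι] {d : ℕ} :
    IsClosed {w : (ι → Euc d) × Euc d | w.2 ∈ convexHull ℝ (Set.range w.1)} := by
  have h : IsClosed {w : stdSimplex ℝ ι × ((ι → Euc d) × Euc d) |
      ∑ i, w.1.1 i • w.2.1 i = w.2.2} := by
    refine isClosed_eq ?_ (by fun_prop)
    refine continuous_finsetSum _ fun i _ => ?_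
    exact ((continuous_apply i).comp (continuous_subtype_val.comp continuous_fst)).smul
      (by fun_prop)
  have := isClosedMap_snd_of_compactSpace _ h
  convert this using 1
  ext w
  simp only [Set.mem_ofPred_eq, mem_convexHull_range_iff, Set.mem_image, Prod.exists,
    exists_eq_right, Subtype.exists, exists_prop]

/-- The vertices of the standard simplex. -/
noncomputable def stdVertex (d : ℕ) : Fin (d + 1) → Euc d :=
  Fin.cons 0 fun i => EuclideanSpace.single i 1

theorem edgeDet_stdVertex (d : ℕ) : edgeDet (stdVertex d) = 1 := by
  rw [edgeDet, ← Matrix.det_one (n := Fin d)]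
  congr 1
  ext i j
  simp [stdVertex, Matrix.one_apply, eq_comm]

theorem exists_linearMap_stdVertex {d : ℕ} (z : Fin (d + 1) → Euc d) :
    ∃ L : Euc d →ₗ[ℝ] Euc d, (fun i => L (stdVertex d i) + z 0) = z := by
  refine ⟨(EuclideanSpace.basisFun (Fin d) ℝ).toBasis.constr ℝ fun i => z i.succ - z 0, ?_⟩
  ext1 i
  refine Fin.cases (by simp [stdVertex]) (fun i => ?_) i
  have := (EuclideanSpace.basisFun (Fin d) ℝ).toBasis.constr_basis ℝ (fun i => z i.succ - z 0) i
  simp only [OrthonormalBasis.coe_toBasis, EuclideanSpace.basisFun_apply] at this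
  simp [stdVertex, this]

/-- The volume of the standard simplex. -/
noncomputable def stdSimplexVolume (d : ℕ) : ℝ :=
  volume.real (convexHull ℝ (Set.range (stdVertex d)))

theorem isCompact_convexHull_range {d m : ℕ} (z : Fin m → Euc d) :
    IsCompact (convexHull ℝ (Set.range z)) :=
  (Set.finite_range z).isCompact_convexHull ℝ

theorem stdSimplexVolume_pos (d : ℕ) : 0 < stdSimplexVolume d := by
  have h : AffineIndependent ℝ (stdVertex d) :=
    affineIndependent_iff_edgeDet_ne_zero.2 (by simp [edgeDet_stdVertex])
  have h1 := (interior_convexHull_nonempty_iff_affineSpan_eq_top).2 h.span_range_eq_top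
  exact ENNReal.toReal_pos (Measure.measure_pos_of_nonempty_interior _ h1).ne'
    (isCompact_convexHull_range _).measure_lt_top.ne

theorem volume_convexHull_range {d : ℕ} (z : Fin (d + 1) → Euc d) :
    volume.real (convexHull ℝ (Set.range z)) = stdSimplexVolume d * |edgeDet z| := by
  obtain ⟨L, hL⟩ := exists_linearMap_stdVertex z
  have h1 : edgeDet z = LinearMap.det L := by
    conv_lhs => rw [← hL]
    rw [edgeDet_map_add, edgeDet_stdVertex, mul_one]
  have h2 : convexHull ℝ (Set.range z) =
      (fun y => y + z 0) '' (L '' convexHull ℝ (Set.range (stdVertex d))) := by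
    ext y
    conv_lhs => rw [← hL]
    simp only [mem_convexHull_range_iff, Set.mem_image, exists_exists_and_eq_and]
    refine exists_congr fun w => and_congr_right fun hw => ?_
    simp only [smul_add, Finset.sum_add_distrib, ← Finset.sum_smul, hw.2, one_smul, map_sum,
      map_smul]
  rw [h1, h2, measureReal_def, Set.image_add_right, measure_preimage_add_right,
    Measure.addHaar_image_linearMap, ENNReal.toReal_mul, ENNReal.toReal_ofReal (abs_nonneg _),
    mul_comm]
  rfl

theorem unif_eq_restrict {d : ℕ} {K : Set (Euc d)} (hv : volume K = 1) :
    unif K = volume.restrict K := by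
  rw [unif, hv, inv_one, one_smul]

theorem isProbabilityMeasure_restrict {d : ℕ} {K : Set (Euc d)} (hv : volume K = 1) :
    IsProbabilityMeasure (volume.restrict K) :=
  ⟨by rw [Measure.restrict_apply_univ, hv]⟩

theorem pi_restrict_eq {d n : ℕ} (K : Set (Euc d)) :
    (Measure.pi fun _ : Fin n => volume.restrict K) =
      (volume : Measure (Fin n → Euc d)).restrict (Set.univ.pi fun _ => K) :=
  (Measure.restrict_pi_pi (fun _ : Fin n => (volume : Measure (Euc d))) fun _ => K).symm

theorem pi_restrict_edgeDet_le {d : ℕ} {K : Set (Euc d)} (s : ℝ) :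
    (Measure.pi fun _ : Fin (d + 1) => volume.restrict K) {z | |edgeDet z| ≤ s} =
      volume (smallSet K s) := by
  rw [pi_restrict_eq, Measure.restrict_apply
    (measurableSet_le continuous_edgeDet.abs.measurable measurable_const)]
  congr 1
  ext z
  simp [smallSet, and_comm]

theorem ae_fullyIndependent {k : ℕ} {K : Set (Euc (k + 1))} (hc : IsCompact K)
    (hv : volume K = 1) (n : ℕ) :
    ∀ᵐ x ∂(Measure.pi fun _ : Fin n => volume.restrict K), FullyIndependent x := by
  have := isProbabilityMeasure_restrict hv
  refine ae_all_iff.2 fun f => ?_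
  by_cases hf : Function.Injective f
  · have h0 : ∀ᵐ z ∂(Measure.pi fun _ : Fin (k + 2) => volume.restrict K), edgeDet z ≠ 0 := by
      rw [ae_iff]
      have h1 := (pi_restrict_edgeDet_le (K := K) 0).trans (volume_smallSet_zero hc)
      simpa using h1
    filter_upwards [(measurePreserving_comp_injective (volume.restrict K) hf).quasiMeasurePreserving.ae
      h0] with x hx _
    exact affineIndependent_iff_edgeDet_ne_zero.2 hx
  · exact Eventually.of_forall fun x h => absurd h hf

theorem ae_convexHull_range_subset {d m : ℕ} {K : Set (Euc d)} (hK : Convex ℝ K)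
    (hc : IsCompact K) :
    ∀ᵐ z ∂(Measure.pi fun _ : Fin m => volume.restrict K), convexHull ℝ (Set.range z) ⊆ K := by
  rw [pi_restrict_eq]
  filter_upwards [ae_restrict_mem (MeasurableSet.univ_pi fun _ => hc.measurableSet)] with z hz
  refine convexHull_min ?_ hK
  rintro _ ⟨i, rfl⟩
  exact hz i trivial

theorem ae_mul_edgeDet_le_one {d : ℕ} {K : Set (Euc d)} (hK : Convex ℝ K)
    (hc : IsCompact K) (hv : volume K = 1) :
    ∀ᵐ z ∂(Measure.pi fun _ : Fin (d + 1) => volume.restrict K),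
      stdSimplexVolume d * |edgeDet z| ≤ 1 := by
  filter_upwards [ae_convexHull_range_subset hK hc] with z hz
  rw [← volume_convexHull_range]
  refine (measureReal_mono hz hc.measure_lt_top.ne).trans_eq ?_
  rw [measureReal_def, hv, ENNReal.toReal_one]

open Classical in
theorem EH_eq {k : ℕ} {K : Set (Euc (k + 1))} (hK : Convex ℝ K) (hc : IsCompact K)
    (hv : volume K = 1) {n : ℕ} (hn : k + 2 ≤ n) :
    EH (k + 1) (k + 2) K n = n.choose (k + 2) *
      ∫ z, (1 - stdSimplexVolume (k + 1) * |edgeDet z|) ^ (n - (k + 2))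
        ∂(Measure.pi fun _ : Fin (k + 2) => volume.restrict K) := by
  have := isProbabilityMeasure_restrict hv
  set μ : Measure (Euc (k + 1)) := volume.restrict K with hμ
  let E : Finset (Fin n) → Set (Fin n → Euc (k + 1)) := fun I =>
    {x | ∀ j ∉ I, x j ∉ convexHull ℝ (x '' I)}
  let A : Set ((Fin (k + 2) → Euc (k + 1)) × Euc (k + 1)) :=
    {w | w.2 ∈ convexHull ℝ (Set.range w.1)}ᶜ
  have hA : MeasurableSet A := isClosed_mem_convexHull_range.measurableSet.compl
  have hE : ∀ I : Finset (Fin n), I.card = k + 2 → MeasurableSet (E I) ∧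
      (Measure.pi fun _ : Fin n => μ).real (E I) =
        ∫ z, (1 - stdSimplexVolume (k + 1) * |edgeDet z|) ^ (n - (k + 2))
          ∂(Measure.pi fun _ : Fin (k + 2) => μ) := by
    intro I hI
    obtain ⟨f, hf, hr⟩ := exists_injective_range_eq hI
    have e : E I = {x | ∀ j ∉ Set.range f, (fun i => x (f i), x j) ∈ A} := by
      ext x
      have h1 : x '' I = Set.range fun i => x (f i) := by
        rw [← hr, ← Set.range_comp]; rfl
      simp only [E, A, Set.mem_ofPred_eq, h1, Set.mem_compl_iff, hr, Finset.mem_coe]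
    constructor
    · rw [e]
      simp only [Set.ofPred_forall]
      refine MeasurableSet.iInter fun j => MeasurableSet.iInter fun _ => ?_
      have hm : Measurable fun x : Fin n → Euc (k + 1) => ((fun i => x (f i)), x j) := by fun_prop
      exact hm hA
    · rw [e, measureReal_def, measure_pi_forall_notMem_range μ hf hA]
      rw [integral_eq_lintegral_of_nonneg_ae]
      · congr 1
        refine lintegral_congr_ae ?_
        filter_upwards [ae_convexHull_range_subset hK hc, ae_mul_edgeDet_le_one hK hc hv]
          with z hz hz1
        have h2 : {y | (z, y) ∈ A} = (convexHull ℝ (Set.range z))ᶜ := rfl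
        have hm := (isCompact_convexHull_range z).measurableSet
        rw [h2, prob_compl_eq_one_sub hm, hμ, Measure.restrict_apply hm,
          Set.inter_eq_left.2 hz, ENNReal.ofReal_pow (sub_nonneg.2 hz1),
          ENNReal.ofReal_sub _ (by have := stdSimplexVolume_pos (k + 1); positivity),
          ENNReal.ofReal_one, ← volume_convexHull_range,
          ofReal_measureReal (isCompact_convexHull_range z).measure_lt_top.ne]
      · filter_upwards [ae_mul_edgeDet_le_one hK hc hv] with z hz
        exact pow_nonneg (sub_nonneg.2 hz) _
      · exact (((continuous_const.sub (continuous_const.mul continuous_edgeDet.abs)).pow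
          _).aestronglyMeasurable)
  have hcount : ∀ᵐ x ∂(Measure.pi fun _ : Fin n => μ), (holeCount (k + 1) (k + 2) n x : ℝ) =
      ∑ I ∈ Finset.powersetCard (k + 2) (Finset.univ : Finset (Fin n)),
        (E I).indicator (fun _ => (1 : ℝ)) x := by
    filter_upwards [ae_fullyIndependent hc hv n] with x hx
    rw [hx.holeCount_eq hn, Finset.card_filter, Nat.cast_sum]
    refine Finset.sum_congr rfl fun I _ => ?_
    simp [Set.indicator_apply, E]
  rw [EH, unif_eq_restrict hv, integral_congr_ae hcount, integral_finsetSum]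
  · rw [Finset.sum_congr rfl (g := fun _ =>
      ∫ z, (1 - stdSimplexVolume (k + 1) * |edgeDet z|) ^ (n - (k + 2))
          ∂(Measure.pi fun _ : Fin (k + 2) => μ))]
    · simp
    · intro I hI
      have := hE I (Finset.mem_powersetCard_univ.1 hI)
      rw [← this.2, integral_indicator_const _ this.1]
      simp
  · intro I hI
    have := hE I (Finset.mem_powersetCard_univ.1 hI)
    exact (integrable_const _).indicator this.1

theorem tendsto_choose_div (k : ℕ) :
    Tendsto (fun n : ℕ => (n.choose (k + 1) : ℝ) / (n : ℝ) ^ k / ((n - (k + 1) : ℕ) : ℝ))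
      atTop (nhds (1 / (k + 1).factorial)) := by
  have h1 : Tendsto (fun n : ℕ => (n.choose (k + 1) : ℝ) * (1 / (n : ℝ)) ^ (k + 1)) atTop
      (nhds (1 ^ (k + 1) / (k + 1).factorial)) := by
    refine ProbabilityTheory.tendsto_choose_mul_pow_atTop (k + 1) ?_
    refine tendsto_const_nhds.congr' ?_
    filter_upwards [eventually_gt_atTop 0] with n hn
    have : (n : ℝ) ≠ 0 := by positivity
    field_simp
  have h2 : Tendsto (fun n : ℕ => (n : ℝ) / ((n - (k + 1) : ℕ) : ℝ)) atTop (nhds 1) := by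
    rw [← tendsto_add_atTop_iff_nat (k + 1)]
    simp only [Nat.add_sub_cancel]
    have h3 : Tendsto (fun n : ℕ => 1 + ((k + 1 : ℕ) : ℝ) / (n : ℝ)) atTop (nhds (1 + 0)) :=
      tendsto_const_nhds.add (tendsto_const_div_atTop_nhds_zero_nat _)
    rw [add_zero] at h3
    refine h3.congr' ?_
    filter_upwards [eventually_gt_atTop 0] with n hn
    have : (n : ℝ) ≠ 0 := by positivity
    push_cast
    field_simp
  have h3 := h1.mul h2
  rw [one_pow, mul_one] at h3
  refine h3.congr' ?_
  filter_upwards [eventually_gt_atTop (k + 1)] with n hn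
  have : (n : ℝ) ≠ 0 := by
    have : 0 < n := by omega
    positivity
  have : ((n - (k + 1) : ℕ) : ℝ) ≠ 0 := by
    have : 0 < n - (k + 1) := by omega
    positivity
  rw [one_div, inv_pow]
  field_simp
  ring

theorem tendsto_EH {k : ℕ} {K : Set (Euc (k + 1))} (hK : Convex ℝ K) (hc : IsCompact K)
    (hv : volume K = 1) {g : ℝ}
    (hg : Tendsto (fun s => volume.real (smallSet K s) / s) (nhdsWithin 0 (Set.Ioi 0)) (nhds g)) :
    Tendsto (fun n : ℕ => EH (k + 1) (k + 2) K n / (n : ℝ) ^ (k + 1)) atTop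
      (nhds (1 / (k + 2).factorial * (g / stdSimplexVolume (k + 1)))) := by
  have := isProbabilityMeasure_restrict hv
  set κ := stdSimplexVolume (k + 1) with hκ
  have hκ0 : 0 < κ := stdSimplexVolume_pos _
  set P := Measure.pi fun _ : Fin (k + 2) => volume.restrict K with hP
  have hset : ∀ s, P.real {z | κ * |edgeDet z| ≤ s} = volume.real (smallSet K (s / κ)) := by
    intro s
    simp only [← le_div_iff₀' hκ0]
    rw [measureReal_def, hP, pi_restrict_edgeDet_le]
    rfl
  have h1 : Tendsto (fun n : ℕ => (n : ℝ) * ∫ z, (1 - κ * |edgeDet z|) ^ n ∂P) atTop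
      (nhds (g / κ)) := by
    refine tendsto_mul_integral_one_sub_pow P (V := fun z => κ * |edgeDet z|)
      (continuous_const.mul continuous_edgeDet.abs).measurable
      (Eventually.of_forall fun z => mul_nonneg hκ0.le (abs_nonneg _)) (ae_mul_edgeDet_le_one hK hc hv) ?_ ?_
    · rw [hset, zero_div, measureReal_def, volume_smallSet_zero hc, ENNReal.toReal_zero]
    · simp only [hset]
      have h2 : Tendsto (fun s : ℝ => s / κ) (nhdsWithin 0 (Set.Ioi 0))
          (nhdsWithin 0 (Set.Ioi 0)) := by
        refine tendsto_nhdsWithin_iff.2 ⟨?_, ?_⟩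
        · have : Tendsto (fun s : ℝ => s / κ) (nhds 0) (nhds (0 / κ)) :=
            (continuous_id.div_const κ).tendsto 0
          rw [zero_div] at this
          exact this.mono_left nhdsWithin_le_nhds
        · filter_upwards [self_mem_nhdsWithin] with s hs
          exact div_pos hs hκ0
      refine ((hg.comp h2).div_const κ).congr fun s => ?_
      simp only [Function.comp_apply]
      field_simp
  have h2 := (tendsto_choose_div (k + 1)).mul (h1.comp (tendsto_sub_atTop_nat (k + 2)))
  refine h2.congr' ?_
  filter_upwards [eventually_gt_atTop (k + 2)] with n hn
  rw [EH_eq hK hc hv hn.le, ← hκ, ← hP]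
  have : ((n - (k + 2) : ℕ) : ℝ) ≠ 0 := by
    have : 0 < n - (k + 2) := by omega
    positivity
  simp only [Function.comp_apply]
  field_simp

theorem volume_smallSet_preimage_add {d : ℕ} (K : Set (Euc d)) (c : Euc d) (s : ℝ) :
    volume (smallSet ((fun y => y + c) ⁻¹' K) s) = volume (smallSet K s) := by
  rw [← measure_preimage_add_right volume (fun _ : Fin (d + 1) => c) (smallSet K s)]
  congr 1
  ext x
  have h := edgeDet_map_add LinearMap.id c x
  simp only [LinearMap.id_apply, LinearMap.det_id, one_mul] at h
  have e : x + (fun _ => c) = fun i => x i + c := rfl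
  simp [smallSet, e, h]

theorem exists_volume_smallSet_preimage_linear {d : ℕ} {L : Euc d →ₗ[ℝ] Euc d}
    (hL : LinearMap.det L ≠ 0) : ∃ C : ℝ, 0 < C ∧ ∀ (K : Set (Euc d)) (s : ℝ),
      volume.real (smallSet (L ⁻¹' K) s) = C * volume.real (smallSet K (|LinearMap.det L| * s)) := by
  let Λ := LinearEquiv.piCongrRight fun _ : Fin (d + 1) => LinearMap.equivOfDetNeZero L hL
  have hΛ : LinearMap.det (Λ : (Fin (d + 1) → Euc d) →ₗ[ℝ] _) ≠ 0 :=
    (LinearEquiv.isUnit_det' Λ).ne_zero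
  refine ⟨|(LinearMap.det (Λ : (Fin (d + 1) → Euc d) →ₗ[ℝ] _))⁻¹|, by positivity, fun K s => ?_⟩
  have h := Measure.addHaar_preimage_linearMap (volume : Measure (Fin (d + 1) → Euc d)) hΛ
    (smallSet K (|LinearMap.det L| * s))
  have e : smallSet (L ⁻¹' K) s = (Λ : (Fin (d + 1) → Euc d) →ₗ[ℝ] _) ⁻¹'
      smallSet K (|LinearMap.det L| * s) := by
    ext x
    have h1 := edgeDet_map_add L 0 x
    simp only [add_zero] at h1
    have h2 : Λ x = fun i => L (x i) := rfl
    have h3 : 0 < |LinearMap.det L| := by positivity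
    simp [smallSet, h2, h1, abs_mul, mul_le_mul_iff_right₀ h3]
  rw [measureReal_def, e, h, ENNReal.toReal_mul, ENNReal.toReal_ofReal (abs_nonneg _)]
  rfl

theorem volume_smallSet_ne_top {d : ℕ} {K : Set (Euc d)} (hc : IsCompact K) (s : ℝ) :
    volume (smallSet K s) ≠ ∞ := by
  refine ((measure_mono (t := Set.univ.pi fun _ => K) fun x hx i _ => hx.1 i).trans_lt ?_).ne
  exact (isCompact_univ_pi fun _ => hc).measure_lt_top

theorem thinSet_subset_smallSet {k : ℕ} (K : Set (Euc (k + 1)))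
    (Q : Set (Fin (k + 2) → Fin k → ℝ)) (s : ℝ) : thinSet K Q s ⊆ smallSet K s :=
  fun _ hx => ⟨hx.1, hx.2.2⟩

theorem volume_thinSet_ne_top {k : ℕ} {K : Set (Euc (k + 1))} (hc : IsCompact K)
    (Q : Set (Fin (k + 2) → Fin k → ℝ)) (s : ℝ) : volume (thinSet K Q s) ≠ ∞ :=
  ((measure_mono (thinSet_subset_smallSet K Q s)).trans_lt (volume_smallSet_ne_top hc s).lt_top).ne

theorem monotone_volume_thinSet {k : ℕ} {K : Set (Euc (k + 1))} (hc : IsCompact K)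
    (Q : Set (Fin (k + 2) → Fin k → ℝ)) : Monotone fun s => volume.real (thinSet K Q s) :=
  fun _ _ h => measureReal_mono (fun _ hx => ⟨hx.1, hx.2.1, hx.2.2.trans h⟩)
    (volume_thinSet_ne_top hc _ _)

theorem volumeReal_thinSet_add_le {k : ℕ} {K : Set (Euc (k + 1))} (hK : Convex ℝ K)
    (hc : IsCompact K) (hs : ∀ p, ∀ t ∈ fiber K p, -t ∈ fiber K p)
    {Q : Set (Fin (k + 2) → Fin k → ℝ)} (hQ : MeasurableSet Q) (a b : ℝ) :
    volume.real (thinSet K Q (a + b)) ≤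
      volume.real (thinSet K Q a) + volume.real (thinSet K Q b) := by
  have ha := volume_thinSet_ne_top hc Q a
  have hb := volume_thinSet_ne_top hc Q b
  rw [measureReal_def, measureReal_def, measureReal_def, ← ENNReal.toReal_add ha hb]
  exact ENNReal.toReal_mono (ENNReal.add_ne_top.2 ⟨ha, hb⟩) (volume_thinSet_add_le hK hc hs hQ a b)

theorem exists_tendsto_smallSet_div {k : ℕ} {K : Set (Euc (k + 1))} (hK : Convex ℝ K)
    (hc : IsCompact K) (hs : ∀ p, ∀ t ∈ fiber K p, -t ∈ fiber K p) :
    ∃ g, Tendsto (fun s => volume.real (smallSet K s) / s) (nhdsWithin 0 (Set.Ioi 0)) (nhds g) := by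
  obtain ⟨C, hC, hle⟩ := exists_volume_smallSet_le hc
  simp only [← thinSet_univ] at hle ⊢
  refine exists_tendsto_div_of_subadditive (C := C.toReal) (monotone_volume_thinSet hc _)
    (fun s => measureReal_nonneg) (volumeReal_thinSet_add_le hK hc hs MeasurableSet.univ) ?_
  intro s hs0
  have := ENNReal.toReal_mono (ENNReal.mul_ne_top hC ENNReal.ofReal_ne_top) (hle s hs0)
  rwa [ENNReal.toReal_mul, ENNReal.toReal_ofReal hs0.le] at this

theorem tendsto_mul_nhdsWithin_zero {a : ℝ} (ha : 0 < a) :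
    Tendsto (fun s : ℝ => a * s) (nhdsWithin 0 (Set.Ioi 0)) (nhdsWithin 0 (Set.Ioi 0)) := by
  refine tendsto_nhdsWithin_iff.2 ⟨?_, ?_⟩
  · have : Tendsto (fun s : ℝ => a * s) (nhds 0) (nhds (a * 0)) := by
      exact (continuous_const_mul a).tendsto 0
    rw [mul_zero] at this
    exact this.mono_left nhdsWithin_le_nhds
  · filter_upwards [self_mem_nhdsWithin] with s hs
    exact mul_pos ha hs

/-- The vertices of a simplex that is symmetric about the first coordinate hyperplane. -/
noncomputable def symmVertex (k : ℕ) : Fin (k + 2) → Euc (k + 1) :=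
  Fin.cons (-EuclideanSpace.single 0 1) fun i => EuclideanSpace.single i 1

theorem swap_zero_one_succ_succ {k : ℕ} (i : Fin k) :
    Equiv.swap (0 : Fin (k + 2)) 1 i.succ.succ = i.succ.succ :=
  Equiv.swap_apply_of_ne_of_ne (Fin.succ_ne_zero _)
    fun h => Fin.succ_ne_zero i (Fin.succ_injective _ h)

theorem symmVertex_swap_tail {k : ℕ} (i : Fin (k + 2)) :
    tailCoord (symmVertex k (Equiv.swap 0 1 i)) = tailCoord (symmVertex k i) := by
  refine Fin.cases ?_ (fun i => Fin.cases ?_ (fun i => ?_) i) i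
  · ext j
    simp [symmVertex, tailCoord]
  · ext j
    simp [symmVertex, tailCoord]
  · rw [swap_zero_one_succ_succ]

theorem symmVertex_swap_zero {k : ℕ} (i : Fin (k + 2)) :
    symmVertex k (Equiv.swap 0 1 i) 0 = -symmVertex k i 0 := by
  refine Fin.cases ?_ (fun i => Fin.cases ?_ (fun i => ?_) i) i
  · simp [symmVertex]
  · simp [symmVertex]
  · rw [swap_zero_one_succ_succ]
    simp [symmVertex]

theorem fiber_symmVertex_symm {k : ℕ} (p : Fin k → ℝ) :
    ∀ t ∈ fiber (convexHull ℝ (Set.range (symmVertex k))) p,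
      -t ∈ fiber (convexHull ℝ (Set.range (symmVertex k))) p := by
  intro t ht
  change joinCoord t p ∈ convexHull ℝ (Set.range (symmVertex k)) at ht
  change joinCoord (-t) p ∈ convexHull ℝ (Set.range (symmVertex k))
  rw [mem_convexHull_range_iff] at ht ⊢
  obtain ⟨w, hw, hsum⟩ := ht
  refine ⟨fun i => w (Equiv.swap 0 1 i), ⟨fun i => hw.1 _, ?_⟩, ?_⟩
  · rw [Equiv.sum_comp (Equiv.swap 0 1) w]; exact hw.2
  · rw [← Equiv.sum_comp (Equiv.swap 0 1)]
    simp only [Equiv.swap_apply_self]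
    refine eq_joinCoord ?_ ?_
    · have := congrArg (fun y : Euc (k + 1) => y 0) hsum
      simp only [joinCoord_zero] at this
      rw [← this]
      simp [symmVertex_swap_zero]
    · rw [← tailCoord_joinCoord t p, ← hsum]
      ext j
      have h := fun i => congrFun (symmVertex_swap_tail (k := k) i) j
      simp only [tailCoord] at h
      simp [tailCoord, h]

theorem exists_linearMap_symmVertex {k : ℕ} (v : Fin (k + 2) → Euc (k + 1)) :
    ∃ (L : Euc (k + 1) →ₗ[ℝ] Euc (k + 1)) (m : Euc (k + 1)),
      (fun i => L (symmVertex k i) + m) = v := by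
  let m := (1 / 2 : ℝ) • (v 0 + v 1)
  let u : Fin (k + 1) → Euc (k + 1) := fun i => v i.succ - m
  refine ⟨(EuclideanSpace.basisFun (Fin (k + 1)) ℝ).toBasis.constr ℝ u, m, ?_⟩
  have h := (EuclideanSpace.basisFun (Fin (k + 1)) ℝ).toBasis.constr_basis ℝ u
  simp only [OrthonormalBasis.coe_toBasis, EuclideanSpace.basisFun_apply] at h
  ext1 i
  refine Fin.cases ?_ (fun i => ?_) i
  · simp only [symmVertex, Fin.cons_zero, map_neg, h, u, m, Fin.succ_zero_eq_one]
    module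
  · simp [symmVertex, h, u]

theorem exists_tendsto_smallSet_convexHull_div {k : ℕ} {v : Fin (k + 2) → Euc (k + 1)}
    (hv : AffineIndependent ℝ v) :
    ∃ g, Tendsto (fun s => volume.real (smallSet (convexHull ℝ (Set.range v)) s) / s)
      (nhdsWithin 0 (Set.Ioi 0)) (nhds g) := by
  obtain ⟨L, m, hL⟩ := exists_linearMap_symmVertex v
  have hdet : LinearMap.det L ≠ 0 := by
    have h1 := affineIndependent_iff_edgeDet_ne_zero.1 hv
    rw [← hL, edgeDet_map_add] at h1
    exact left_ne_zero_of_mul h1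
  have hpre : L ⁻¹' ((fun y => y + m) ⁻¹' convexHull ℝ (Set.range v)) =
      convexHull ℝ (Set.range (symmVertex k)) := by
    ext y
    have hinj : Function.Injective L := (LinearMap.equivOfDetNeZero L hdet).injective
    conv_lhs => rw [← hL]
    simp only [Set.mem_preimage, mem_convexHull_range_iff]
    refine exists_congr fun w => and_congr_right fun hw => ?_
    rw [← hinj.eq_iff (a := ∑ i, w i • symmVertex k i)]
    simp only [smul_add, Finset.sum_add_distrib, ← Finset.sum_smul, hw.2, one_smul, map_sum,
      map_smul, add_left_inj]
  obtain ⟨g, hg⟩ := exists_tendsto_smallSet_div (convex_convexHull ℝ (Set.range (symmVertex k)))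
    (isCompact_convexHull_range _) fiber_symmVertex_symm
  obtain ⟨C, hC, hCK⟩ := exists_volume_smallSet_preimage_linear hdet
  set a := |LinearMap.det L| with ha
  have ha0 : 0 < a := by positivity
  refine ⟨g / (C * a), ((hg.comp (tendsto_mul_nhdsWithin_zero (inv_pos.2 ha0))).div_const
    (C * a)).congr fun s => ?_⟩
  simp only [Function.comp_apply]
  rw [← hpre, hCK, measureReal_def, volume_smallSet_preimage_add, measureReal_def]
  field_simp

theorem exists_tendsto_smallSet_closedBall_div {k : ℕ} (c : Euc (k + 1)) (r : ℝ) :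
    ∃ g, Tendsto (fun s => volume.real (smallSet (Metric.closedBall c r) s) / s)
      (nhdsWithin 0 (Set.Ioi 0)) (nhds g) := by
  obtain ⟨g, hg⟩ := exists_tendsto_smallSet_div (convex_closedBall (0 : Euc (k + 1)) r)
    (isCompact_closedBall _ _) (fiber_closedBall_symm r)
  refine ⟨g, hg.congr fun s => ?_⟩
  have e : (fun y => y + c) ⁻¹' Metric.closedBall c r = Metric.closedBall 0 r := by
    ext y; simp [dist_eq_norm]
  rw [← e, measureReal_def, volume_smallSet_preimage_add, measureReal_def]

theorem AffineIndependent.eq_zero_of_add_smul_mem {d : ℕ} {v : Fin (d + 1) → Euc d}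
    (hv : AffineIndependent ℝ v) {a : Fin 4 → Fin (d + 1)} (ha : Function.Injective a)
    {i : Fin (d + 1)} {t : ℝ}
    (h : v i + t • (v (a 0) + v (a 1) - (v (a 2) + v (a 3))) ∈ convexHull ℝ (Set.range v)) :
    t = 0 := by
  let b : AffineBasis (Fin (d + 1)) ℝ (Euc d) := ⟨v, hv, hv.span_range_eq_top⟩
  change _ ∈ convexHull ℝ (Set.range b) at h
  rw [b.convexHull_eq_nonneg_coord] at h
  have hcoord : ∀ j l, b.coord j (v l) = if j = l then 1 else 0 := fun j l => b.coord_apply j l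
  have key : ∀ j, b.coord j (v i + t • (v (a 0) + v (a 1) - (v (a 2) + v (a 3)))) =
      b.coord j (v i) + t * ((b.coord j (v (a 0)) - b.coord j (v (a 2))) +
        (b.coord j (v (a 1)) - b.coord j (v (a 3)))) := by
    intro j
    have e : v i + t • (v (a 0) + v (a 1) - (v (a 2) + v (a 3))) =
        t • ((v (a 0) -ᵥ v (a 2)) + (v (a 1) -ᵥ v (a 3))) +ᵥ v i := by
      simp only [vsub_eq_sub, vadd_eq_add]
      module
    rw [e, AffineMap.map_vadd, map_smul, map_add, AffineMap.linearMap_vsub,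
      AffineMap.linearMap_vsub]
    simp only [vsub_eq_sub, vadd_eq_add, smul_eq_mul]
    ring
  have h0 := fun j => (h j).trans_eq (key j)
  have hne : ∀ p q : Fin 4, p ≠ q → a p ≠ a q := fun p q h => ha.ne h
  have n01 := hne 0 1 (by decide)
  have n02 := hne 0 2 (by decide)
  have n03 := hne 0 3 (by decide)
  have n12 := hne 1 2 (by decide)
  have n13 := hne 1 3 (by decide)
  have n23 := hne 2 3 (by decide)
  have g0 := h0 (a 0)
  have g1 := h0 (a 1)
  have g2 := h0 (a 2)
  have g3 := h0 (a 3)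
  simp only [hcoord] at g0 g1 g2 g3
  have hpos : 0 ≤ t := by
    by_cases hi : a 0 = i
    · subst hi; simp_all [n01.symm]
    · simp_all
  have hneg : t ≤ 0 := by
    by_cases hi : a 2 = i
    · subst hi; simp_all [n02.symm, n12.symm, n03.symm, n13.symm, n23.symm]
    · simp_all [n02.symm, n12.symm, n03.symm, n13.symm, n23.symm]
  linarith

theorem eq_add_smul_of_tailCoord_eq {k : ℕ} {x y : Euc (k + 1)} (h : tailCoord x = tailCoord y)
    {a : ℝ} (ha : a ≠ 0) : x = y + ((x 0 - y 0) / a) • joinCoord a 0 := by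
  ext j
  refine Fin.cases ?_ (fun j => ?_) j
  · simp; field_simp; ring
  · have hj : x j.succ = y j.succ := congrFun h j
    simpa using hj

/-- A set without thin simplices over `Q` loses a linear amount of small simplices
against its symmetrization. -/
theorem exists_gap_of_thinSet_eq_empty {k : ℕ} {A : Set (Euc (k + 1))} (hA : Convex ℝ A)
    (hc : IsCompact A) {Q : Set (Fin (k + 2) → Fin k → ℝ)} (hQ : MeasurableSet Q) {ε s₀ : ℝ}
    (hε : 0 < ε) (hs₀ : 0 < s₀) (hempty : thinSet A Q ε = ∅) (hpos : volume (thinSet A Q s₀) ≠ 0) :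
    ∃ δ > 0, ∀ s, 0 < s → s ≤ ε →
      volume.real (smallSet A s) + δ * s ≤ volume.real (smallSet (steiner A) s) := by
  have hA' := convex_steiner hA
  have hc' := isCompact_steiner hc
  set f : ℝ → ℝ := fun s => volume.real (thinSet (steiner A) Q s) with hf
  have hf0 : 0 < f s₀ := by
    refine ENNReal.toReal_pos ?_ (volume_thinSet_ne_top hc' Q s₀)
    exact fun h => hpos (le_antisymm ((volume_thinSet_le_steiner hA hc hQ s₀).trans h.le) zero_le)
  refine ⟨f s₀ / (s₀ + ε), by positivity, fun s hs hsε => ?_⟩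
  have h1 : f s₀ / (s₀ + ε) * s ≤ f s := by
    have h := subadditive_mul_le (f := f) (monotone_volume_thinSet hc' Q)
      (fun s => measureReal_nonneg)
      (volumeReal_thinSet_add_le hA' hc' (fun p t ht => neg_mem_halfDiff ht) hQ) hs₀ hs
    rw [div_mul_eq_mul_div, div_le_iff₀ (by positivity)]
    refine h.trans ?_
    rw [mul_comm]
    exact mul_le_mul_of_nonneg_left (by linarith) measureReal_nonneg
  have h2 : smallSet A s = thinSet A Qᶜ s := by
    ext x
    refine ⟨fun hx => ⟨hx.1, fun hq => ?_, hx.2⟩, fun hx => ⟨hx.1, hx.2.2⟩⟩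
    have : x ∈ thinSet A Q ε := ⟨hx.1, hq, hx.2.trans hsε⟩
    rw [hempty] at this
    exact this
  have h3 : smallSet (steiner A) s = thinSet (steiner A) Qᶜ s ∪ thinSet (steiner A) Q s := by
    ext x
    by_cases hx : (fun i => tailCoord (x i)) ∈ Q <;> simp [smallSet, thinSet, hx]
  have h4 : Disjoint (thinSet (steiner A) Qᶜ s) (thinSet (steiner A) Q s) :=
    Set.disjoint_left.2 fun x h h' => h.2.1 h'.2.1
  rw [h3, measureReal_union h4 (measurableSet_thinSet hc'.measurableSet hQ s)
    (volume_thinSet_ne_top hc' _ _) (volume_thinSet_ne_top hc' _ _), h2]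
  refine add_le_add ?_ h1
  exact ENNReal.toReal_mono (volume_thinSet_ne_top hc' _ _)
    (volume_thinSet_le_steiner hA hc hQ.compl s)

/-- If `A` meets the vertical lines through the vertices of some nondegenerate simplex of `A`
only in these vertices, then symmetrization strictly increases the number of small simplices. -/
theorem exists_gap_steiner {k : ℕ} {A : Set (Euc (k + 1))} (hA : Convex ℝ A)
    (hc : IsCompact A) (hi : (interior A).Nonempty) {w : Fin (k + 2) → Euc (k + 1)}
    (hw : ∀ i, w i ∈ A) (hdet : edgeDet w ≠ 0)
    (hline : ∀ i, ∀ x ∈ A, tailCoord x = tailCoord (w i) → x = w i) :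
    ∃ δ > 0, ∃ ε > 0, ∀ s, 0 < s → s ≤ ε →
      volume.real (smallSet A s) + δ * s ≤ volume.real (smallSet (steiner A) s) := by
  set T : (Fin (k + 2) → Euc (k + 1)) → Fin (k + 2) → Fin k → ℝ :=
    fun x i => tailCoord (x i) with hT
  have hTc : Continuous T :=
    continuous_pi fun i => continuous_tailCoord.comp (continuous_apply i)
  set ε := |edgeDet w| / 2 with hε
  have hε0 : 0 < ε := by positivity
  have hZ : IsCompact (smallSet A ε) := by
    have h1 : IsCompact (Set.univ.pi fun _ : Fin (k + 2) => A) := isCompact_univ_pi fun _ => hc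
    have h2 := h1.inter_right (isClosed_le continuous_edgeDet.abs (continuous_const (y := ε)))
    convert h2 using 1
    ext x
    simp [smallSet]
  set Q := (T '' smallSet A ε)ᶜ with hQ
  have hQo : IsOpen Q := (hZ.image hTc).isClosed.isOpen_compl
  have hwQ : T w ∈ Q := by
    rintro ⟨x, hx, hxw⟩
    have hxw' : x = w := funext fun i => hline i (x i) (hx.1 i) (congrFun hxw i)
    have := hx.2
    rw [hxw', hε] at this
    have : 0 < |edgeDet w| := by positivity
    linarith
  have hempty : thinSet A Q ε = ∅ :=
    Set.eq_empty_of_forall_notMem fun x hx => hx.2.1 ⟨x, ⟨hx.1, hx.2.2⟩, rfl⟩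
  have hpos : volume (thinSet A Q (|edgeDet w| + 1)) ≠ 0 := by
    set U := T ⁻¹' Q ∩ {x | |edgeDet x| < |edgeDet w| + 1} with hU
    have hUo : IsOpen U := (hQo.preimage hTc).inter
      (isOpen_lt continuous_edgeDet.abs continuous_const)
    have hwU : w ∈ U := ⟨hwQ, lt_add_one |edgeDet w|⟩
    have hcl : w ∈ closure (Set.univ.pi fun _ : Fin (k + 2) => interior A) := by
      rw [closure_pi_set]
      intro i _
      rw [hA.closure_interior_eq_closure_of_nonempty_interior hi]
      exact subset_closure (hw i)
    have hne := mem_closure_iff.1 hcl U hUo hwU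
    have ho : IsOpen (U ∩ Set.univ.pi fun _ : Fin (k + 2) => interior A) :=
      hUo.inter (isOpen_set_pi Set.finite_univ fun _ _ => isOpen_interior)
    refine ((ho.measure_pos volume hne).trans_le (measure_mono ?_)).ne'
    exact fun x hx => ⟨fun i => interior_subset (hx.2 i trivial), hx.1.1, (hx.1.2 : _ < _).le⟩
  obtain ⟨δ, hδ, h⟩ := exists_gap_of_thinSet_eq_empty hA hc hQo.measurableSet hε0
    (by positivity) hempty hpos
  exact ⟨δ, hδ, ε, hε0, h⟩

theorem exists_gap_simplex_ball {k : ℕ} (hk : 2 ≤ k) {v : Fin (k + 2) → Euc (k + 1)}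
    (hv : AffineIndependent ℝ v) (hvol : volume (convexHull ℝ (Set.range v)) = 1) {r : ℝ}
    (hr : volume (Metric.closedBall (0 : Euc (k + 1)) r) = 1) :
    ∃ δ > 0, ∃ ε > 0, ∀ s, 0 < s → s ≤ ε →
      volume.real (smallSet (convexHull ℝ (Set.range v)) s) + δ * s ≤
        volume.real (smallSet (Metric.closedBall (0 : Euc (k + 1)) r) s) := by
  set S := convexHull ℝ (Set.range v) with hS
  have hSc : IsCompact S := isCompact_convexHull_range v
  let a : Fin 4 → Fin (k + 2) := Fin.castLE (by omega)
  have ha : Function.Injective a := Fin.castLE_injective _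
  set u := v (a 0) + v (a 1) - (v (a 2) + v (a 3)) with hu
  have hvS : ∀ i, v i ∈ S := fun i => subset_convexHull ℝ _ ⟨i, rfl⟩
  have hu0 : u ≠ 0 := by
    intro h0
    have h1 : v 0 + (1 : ℝ) • u ∈ S := by rw [h0, smul_zero, add_zero]; exact hvS 0
    exact one_ne_zero (hv.eq_zero_of_add_smul_mem ha h1)
  obtain ⟨σ, hσ⟩ := exists_linearIsometryEquiv_joinCoord u
  have hA : Convex ℝ (σ ⁻¹' S) := (convex_convexHull ℝ _).linear_preimage
    (σ.toLinearEquiv : Euc (k + 1) →ₗ[ℝ] Euc (k + 1))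
  have hAc : IsCompact (σ ⁻¹' S) := σ.toHomeomorph.isCompact_preimage.2 hSc
  have hAi : (interior (σ ⁻¹' S)).Nonempty := by
    have h1 := interior_convexHull_nonempty_iff_affineSpan_eq_top.2 hv.span_range_eq_top
    have h2 : σ ⁻¹' interior S = interior (σ ⁻¹' S) := σ.toHomeomorph.preimage_interior S
    rw [← h2]
    exact h1.preimage σ.surjective
  have hdet : edgeDet (fun i => σ.symm (v i)) ≠ 0 := by
    have h1 := edgeDet_map_add (σ.toLinearEquiv : Euc (k + 1) →ₗ[ℝ] Euc (k + 1)) 0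
      fun i => σ.symm (v i)
    have h2 : (fun i => (σ.toLinearEquiv : Euc (k + 1) →ₗ[ℝ] Euc (k + 1)) (σ.symm (v i)) + 0) = v := by
      ext1 i
      simp
    rw [h2] at h1
    exact right_ne_zero_of_mul (h1 ▸ affineIndependent_iff_edgeDet_ne_zero.1 hv)
  obtain ⟨δ, hδ, ε, hε, h⟩ := exists_gap_steiner hA hAc hAi (w := fun i => σ.symm (v i))
    (fun i => by simpa using hvS i) hdet (by
      intro i x hx htail
      have hu1 : ‖u‖ ≠ 0 := norm_ne_zero_iff.2 hu0
      have h1 := eq_add_smul_of_tailCoord_eq htail hu1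
      have h2 : σ x = v i + ((x 0 - (σ.symm (v i)) 0) / ‖u‖) • u := by
        conv_lhs => rw [h1]
        simp [hσ]
      have h3 : (x 0 - (σ.symm (v i)) 0) / ‖u‖ = 0 :=
        hv.eq_zero_of_add_smul_mem ha (by rw [← h2]; exact hx)
      rw [h1, h3, zero_smul, add_zero])
  refine ⟨δ, hδ, ε, hε, fun s hs hsε => ?_⟩
  have h1 : volume.real (smallSet (σ ⁻¹' S) s) = volume.real (smallSet S s) := by
    rw [measureReal_def, volume_smallSet_preimage σ hSc.measurableSet, measureReal_def]
  rw [← h1]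
  refine (h s hs hsε).trans ?_
  refine ENNReal.toReal_mono (volume_smallSet_ne_top (isCompact_closedBall _ _) s) ?_
  refine volume_smallSet_le_closedBall (convex_steiner hA) (isCompact_steiner hAc) ?_ hr s
  rw [volume_steiner hA hAc, σ.measurePreserving.measure_preimage hSc.measurableSet.nullMeasurableSet,
    hvol]

/-- For `d ≥ 3`, a unit-volume `d`-simplex `S` and a unit-volume ball `B` in `ℝ^d`:
the limits `c_S = lim n^{-d} EH^S_{d,d+1}(n)` and `c_B = lim n^{-d} EH^B_{d,d+1}(n)`
exist and satisfy `c_S < c_B`. -/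
theorem statement2 (d : ℕ) (hd : 3 ≤ d) (S B : Set (Euc d))
    (v : Fin (d + 1) → Euc d) (hv : AffineIndependent ℝ v)
    (hS : S = convexHull ℝ (Set.range v)) (hSvol : volume S = 1)
    (c : Euc d) (r : ℝ) (hB : B = Metric.closedBall c r) (hBvol : volume B = 1) :
    ∃ cS cB : ℝ,
      Filter.Tendsto (fun n : ℕ => EH d (d + 1) S n / (n : ℝ) ^ d)
        Filter.atTop (nhds cS) ∧
      Filter.Tendsto (fun n : ℕ => EH d (d + 1) B n / (n : ℝ) ^ d)
        Filter.atTop (nhds cB) ∧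
      cS < cB := by
  obtain ⟨k, rfl⟩ : ∃ k, d = k + 1 := ⟨d - 1, by omega⟩
  subst hS hB
  obtain ⟨gS, hgS⟩ := exists_tendsto_smallSet_convexHull_div hv
  obtain ⟨gB, hgB⟩ := exists_tendsto_smallSet_closedBall_div c r
  have hr : volume (Metric.closedBall (0 : Euc (k + 1)) r) = 1 := by
    rw [← Measure.addHaar_closedBall_center volume c r, hBvol]
  obtain ⟨δ, hδ, ε, hε, h⟩ := exists_gap_simplex_ball (by omega) hv hSvol hr
  have hlt : gS < gB := by
    suffices hle : gS + δ ≤ gB by linarith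
    refine le_of_tendsto_of_tendsto (hgS.add_const δ) hgB ?_
    filter_upwards [Ioc_mem_nhdsGT hε] with s hs
    have hpre : (fun y => y + c) ⁻¹' Metric.closedBall c r = Metric.closedBall 0 r := by
      ext y
      simp [dist_eq_norm]
    have hball := volume_smallSet_preimage_add (Metric.closedBall c r) c s
    rw [hpre] at hball
    have hs' := h s hs.1 hs.2
    rw [measureReal_def (s := smallSet (Metric.closedBall 0 r) s), hball,
      ← measureReal_def] at hs'
    rw [le_div_iff₀ hs.1, add_mul, div_mul_cancel₀ _ hs.1.ne']
    exact hs'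
  refine ⟨_, _, tendsto_EH (convex_convexHull ℝ _) (isCompact_convexHull_range v) hSvol hgS,
    tendsto_EH (convex_closedBall c r) (isCompact_closedBall c r) hBvol hgB, ?_⟩
  have hpos := stdSimplexVolume_pos (k + 1)
  gcongr
end

section
/- Let d ≥ 1 be an integer and let K ⊆ ℝ^d be a convex body. If there exists a volume-preserving affine transformation f : ℝ^d → ℝ^d such that f(K) has diameter D, then p_d^K ≤ (d+2) · D^d / (d! · λ_d(K)), where λ_d(K) is the d-dimensional Lebesgue volume of K. -/
open MeasureTheory Filter

open Set in
/-- The corner simplex `{x ≥ 0, ∑ xᵢ ≤ r}` in `ℝᵈ` has volume at most `rᵈ / d!`. -/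
theorem volume_cornerSimplex_le (d : ℕ) (r : ℝ) :
    volume {x : Fin d → ℝ | (∀ i, 0 ≤ x i) ∧ ∑ i, x i ≤ r} ≤
      ENNReal.ofReal (max r 0 ^ d / d.factorial) := by
  induction d generalizing r with
  | zero =>
    refine (measure_mono (subset_univ _)).trans ?_
    simp [volume_pi]
  | succ d ih =>
    set S : Set (ℝ × (Fin d → ℝ)) :=
      {p | 0 ≤ p.1 ∧ (∀ i, 0 ≤ p.2 i) ∧ p.1 + ∑ i, p.2 i ≤ r}
    have hS : IsClosed S := by
      simp only [S, ofPred_and, ofPred_forall]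
      exact (isClosed_le continuous_const continuous_fst).inter
        ((isClosed_iInter fun i => isClosed_le (by fun_prop) (by fun_prop)).inter
          (isClosed_le (by fun_prop) (by fun_prop)))
    have hpre : {x : Fin (d + 1) → ℝ | (∀ i, 0 ≤ x i) ∧ ∑ i, x i ≤ r} =
        MeasurableEquiv.piFinSuccAbove (fun _ => ℝ) 0 ⁻¹' S := by
      ext x
      simp [S, Fin.forall_fin_succ, Fin.sum_univ_succ, and_assoc, Fin.tail]
    rw [hpre, (volume_preserving_piFinSuccAbove (fun _ : Fin (d + 1) => ℝ) 0).measure_preimage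
      hS.measurableSet.nullMeasurableSet, Measure.volume_eq_prod,
      Measure.prod_apply hS.measurableSet]
    have hslice (t : ℝ) : volume (Prod.mk t ⁻¹' S) ≤
        (Icc 0 (max r 0)).indicator
          (fun t => ENNReal.ofReal ((max r 0 - t) ^ d / d.factorial)) t := by
      by_cases ht : t ∈ Icc 0 r
      · have hr : max r 0 = r := max_eq_left (ht.1.trans ht.2)
        rw [hr, indicator_of_mem ht]
        refine (measure_mono ?_).trans ((ih (r - t)).trans_eq ?_)
        · rintro x ⟨-, hx, hs⟩
          exact ⟨hx, by simp only at hs; linarith⟩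
        · rw [max_eq_left (by linarith [ht.2])]
      · suffices Prod.mk t ⁻¹' S = ∅ by simp [this]
        refine eq_empty_of_forall_notMem ?_
        rintro x ⟨h0, hx, hs⟩
        have := Finset.sum_nonneg fun i (_ : i ∈ Finset.univ) => hx i
        simp only at h0 hs
        exact ht ⟨h0, by linarith⟩
    refine (lintegral_mono hslice).trans ?_
    rw [lintegral_indicator measurableSet_Icc,
      ← ofReal_integral_eq_lintegral_ofReal]
    · refine le_of_eq ?_
      congr 1
      rw [integral_Icc_eq_integral_Ioc,
        ← intervalIntegral.integral_of_le (le_max_right r 0),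
        intervalIntegral.integral_comp_sub_left (fun t => t ^ d / (d.factorial : ℝ))]
      simp only [intervalIntegral.integral_div, integral_pow, sub_self, sub_zero]
      rw [Nat.factorial_succ]
      push_cast
      field_simp
      simp
    · exact Continuous.integrableOn_Icc (by fun_prop)
    · filter_upwards [ae_restrict_mem measurableSet_Icc] with t ht
      have : 0 ≤ max r 0 - t := by linarith [ht.2]
      positivity

/-- Hadamard's inequality for a linear endomorphism of Euclidean space. -/
theorem abs_det_le_prod_norm {d : ℕ} (L : Euc d →ₗ[ℝ] Euc d) :
    |LinearMap.det L| ≤ ∏ i, ‖L (EuclideanSpace.basisFun (Fin d) ℝ i)‖ := by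
  set b := EuclideanSpace.basisFun (Fin d) ℝ
  have : Fact (Module.finrank ℝ (Euc d) = d) := ⟨by simp⟩
  have h := b.toBasis.orientation.abs_volumeForm_apply_le (L ∘ b)
  rw [b.toBasis.orientation.volumeForm_robust' b] at h
  have hdet : b.toBasis.det (L ∘ b) = LinearMap.det L := by
    rw [b.toBasis.det_comp, ← b.coe_toBasis, b.toBasis.det_self, mul_one]
  rwa [hdet] at h

open Set in
/-- The simplex spanned by `y₀, …, y_d` has volume at most `∏ ‖yᵢ - y₀‖ / d!`. -/
theorem volume_convexHull_range_le_prod {d : ℕ} (y : Fin (d + 1) → Euc d) :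
    volume (convexHull ℝ (range y)) ≤
      ENNReal.ofReal ((∏ i : Fin d, ‖y i.succ - y 0‖) / d.factorial) := by
  set b := EuclideanSpace.basisFun (Fin d) ℝ
  set L : Euc d →ₗ[ℝ] Euc d := b.toBasis.constr ℝ fun i => y i.succ - y 0
  have hL (i : Fin d) : L (b i) = y i.succ - y 0 := by
    rw [← b.coe_toBasis]
    exact b.toBasis.constr_basis ℝ _ i
  set T : Set (Euc d) := {t | (∀ i, 0 ≤ t i) ∧ ∑ i, t i ≤ 1}
  have hT : volume T ≤ ENNReal.ofReal (1 / d.factorial) := by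
    have hpre : T = (MeasurableEquiv.toLp 2 (Fin d → ℝ)).symm ⁻¹'
        {x : Fin d → ℝ | (∀ i, 0 ≤ x i) ∧ ∑ i, x i ≤ 1} := rfl
    rw [hpre, (EuclideanSpace.volume_preserving_symm_measurableEquiv_toLp
      (Fin d)).measure_preimage_equiv]
    simpa using volume_cornerSimplex_le d 1
  have hconv : Convex ℝ T := by
    rintro s ⟨hs, hs'⟩ t ⟨ht, ht'⟩ u v hu hv huv
    refine ⟨fun i => ?_, ?_⟩
    · have := hs i
      have := ht i
      simp only [PiLp.add_apply, PiLp.smul_apply, smul_eq_mul]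
      positivity
    · simp only [PiLp.add_apply, PiLp.smul_apply, smul_eq_mul, Finset.sum_add_distrib,
        ← Finset.mul_sum]
      nlinarith
  have hsub : convexHull ℝ (range y) ⊆ (fun z => y 0 + z) '' (L '' T) := by
    refine convexHull_min ?_ ((hconv.linear_image L).translate (y 0))
    rintro _ ⟨j, rfl⟩
    refine j.cases ?_ fun i => ?_
    · exact ⟨0, ⟨0, ⟨by simp, by simp⟩, by simp⟩, by simp⟩
    · refine ⟨L (b i), ⟨b i, ⟨fun k => ?_, ?_⟩, rfl⟩, by simp [hL]⟩
      · by_cases h : k = i <;> simp [b, h]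
      · simp [b]
  calc volume (convexHull ℝ (range y)) ≤ volume ((fun z => y 0 + z) '' (L '' T)) :=
        measure_mono hsub
    _ = ENNReal.ofReal |LinearMap.det L| * volume T := by
        rw [image_add_left, measure_preimage_add, Measure.addHaar_image_linearMap]
    _ ≤ ENNReal.ofReal (∏ i : Fin d, ‖y i.succ - y 0‖) * ENNReal.ofReal (1 / d.factorial) := by
        gcongr
        simpa only [← hL] using abs_det_le_prod_norm L
    _ = _ := by
        rw [← ENNReal.ofReal_mul (by positivity), mul_one_div]

open Set in
/-- Membership in the convex hull of finitely many points is a closed condition. -/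
theorem isClosed_mem_convexHull_range_s5 {n d : ℕ} :
    IsClosed {p : Euc d × (Fin n → Euc d) | p.1 ∈ convexHull ℝ (range p.2)} := by
  have hC : IsClosed {q : (Euc d × (Fin n → Euc d)) × stdSimplex ℝ (Fin n) |
      ∑ j, (q.2.1 : Fin n → ℝ) j • q.1.2 j = q.1.1} :=
    isClosed_eq (continuous_finsetSum _ fun j _ =>
      ((continuous_apply j).comp (continuous_subtype_val.comp continuous_snd)).smul
        (by fun_prop)) (by fun_prop)
  convert isClosedMap_fst_of_compactSpace _ hC using 1
  ext ⟨p, y⟩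
  have hull : convexHull ℝ (range y) = Fintype.linearCombination ℝ y '' stdSimplex ℝ (Fin n) := by
    rw [← convexHull_rangle_single_eq_stdSimplex, LinearMap.image_convexHull, ← range_comp]
    congr 2
    ext1 j
    simp
  simp [hull, Fintype.linearCombination_apply]

open Set in
/-- A simplex with vertices in `K` has volume at most `diam (f(K))ᵈ / d!` for every
volume-preserving affine `f`. -/
theorem volume_convexHull_range_le {d : ℕ} {K : Set (Euc d)} (hK : IsCompact K)
    (f : Euc d ≃ᵃ[ℝ] Euc d)
    (hf : |LinearMap.det (f.linear : Euc d →ₗ[ℝ] Euc d)| = 1)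
    {y : Fin (d + 1) → Euc d} (hy : ∀ j, y j ∈ K) :
    volume (convexHull ℝ (range y)) ≤
      ENNReal.ofReal (Metric.diam (f '' K) ^ d / d.factorial) := by
  have hvol (s : Set (Euc d)) : volume (f '' s) = volume s := by
    have himg : f '' s = (fun z => f 0 + z) '' ((f.linear : Euc d →ₗ[ℝ] Euc d) '' s) := by
      rw [image_image]
      refine image_congr fun z _ => ?_
      simpa [add_comm] using f.map_vadd 0 z
    rw [himg, image_add_left, measure_preimage_add, Measure.addHaar_image_linearMap, hf]
    simp
  have hbdd : Bornology.IsBounded (f '' K) :=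
    (hK.image f.continuous_of_finiteDimensional).isBounded
  have hhull : f '' convexHull ℝ (range y) = convexHull ℝ (range (f ∘ y)) := by
    rw [range_comp]
    exact f.toAffineMap.image_convexHull _
  rw [← hvol, hhull]
  refine (volume_convexHull_range_le_prod _).trans (ENNReal.ofReal_le_ofReal ?_)
  gcongr
  calc ∏ i : Fin d, ‖(f ∘ y) i.succ - (f ∘ y) 0‖ ≤ ∏ _i : Fin d, Metric.diam (f '' K) := by
        refine Finset.prod_le_prod (fun _ _ => norm_nonneg _) fun i _ => ?_
        rw [← dist_eq_norm]
        exact Metric.dist_le_diam_of_mem hbdd (mem_image_of_mem f (hy _))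
          (mem_image_of_mem f (hy _))
    _ = _ := by simp

theorem isProbabilityMeasure_unif {d : ℕ} {K : Set (Euc d)} (hK : IsConvexBody K) :
    IsProbabilityMeasure (unif K) :=
  ⟨by
    rw [unif, Measure.smul_apply, Measure.restrict_apply_univ, smul_eq_mul]
    exact ENNReal.inv_mul_cancel (Measure.measure_pos_of_nonempty_interior _ hK.2.2).ne'
      hK.2.1.measure_ne_top⟩

open Set in
/-- If all simplices with vertices in `K` have volume at most `c`, then the probability that a
given one of `n + 1` uniform points lies in the hull of the others is at most `c / λ(K)`. -/
theorem pi_unif_mem_convexHull_le {d n : ℕ} {K : Set (Euc d)} (hK : IsConvexBody K)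
    {c : ENNReal} (hc : ∀ y : Fin n → Euc d, (∀ j, y j ∈ K) →
      volume (convexHull ℝ (range y)) ≤ c) (i : Fin (n + 1)) :
    (Measure.pi fun _ : Fin (n + 1) => unif K)
      {x | x i ∈ convexHull ℝ (x '' {j | j ≠ i})} ≤ (volume K)⁻¹ * c := by
  have := isProbabilityMeasure_unif hK
  set C := {p : Euc d × (Fin n → Euc d) | p.1 ∈ convexHull ℝ (range p.2)}
  have hC : MeasurableSet C := isClosed_mem_convexHull_range_s5.measurableSet
  have hpre : {x : Fin (n + 1) → Euc d | x i ∈ convexHull ℝ (x '' {j | j ≠ i})} =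
      MeasurableEquiv.piFinSuccAbove (fun _ => Euc d) i ⁻¹' C := by
    ext x
    have : x '' {j | j ≠ i} = range (i.removeNth x) := by
      have : {j | j ≠ i} = range i.succAbove := by
        rw [Fin.range_succAbove]; rfl
      rw [this, ← range_comp]
      rfl
    simp [C, this]
  rw [hpre, (measurePreserving_piFinSuccAbove (fun _ => unif K) i).measure_preimage
    hC.nullMeasurableSet, Measure.prod_apply_symm hC]
  have hmem : ∀ᵐ y ∂(Measure.pi fun _ : Fin n => unif K), ∀ j, y j ∈ K := by
    refine ae_all_iff.2 fun j => ?_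
    have h : ∀ᵐ z ∂(unif K), z ∈ K :=
      Measure.ae_smul_measure (ae_restrict_mem hK.2.1.measurableSet) _
    exact Measure.tendsto_eval_ae_ae.eventually h
  calc ∫⁻ y, unif K ((fun z => (z, y)) ⁻¹' C) ∂(Measure.pi fun _ : Fin n => unif K)
      ≤ ∫⁻ _, (volume K)⁻¹ * c ∂(Measure.pi fun _ : Fin n => unif K) := by
        refine lintegral_mono_ae ?_
        filter_upwards [hmem] with y hy
        rw [unif, Measure.smul_apply, smul_eq_mul]
        gcongr
        exact (Measure.restrict_apply_le _ _).trans (hc y hy)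
    _ = (volume K)⁻¹ * c := by simp

/-- If `K ⊆ ℝ^d` (`d ≥ 1`) is a convex body and there is a volume-preserving
affine transformation `f` of `ℝ^d` such that `f(K)` has diameter `D`, then
`p_d^K ≤ (d+2) · D^d / (d! · λ_d(K))`. -/
theorem statement5 (d : ℕ) (hd : 1 ≤ d) (K : Set (Euc d)) (hK : IsConvexBody K)
    (f : Euc d ≃ᵃ[ℝ] Euc d)
    (hf : |LinearMap.det (f.linear : Euc d →ₗ[ℝ] Euc d)| = 1)
    (D : ℝ) (hD : Metric.diam (⇑f '' K) = D) :
    pSimplex d K ≤ ((d : ℝ) + 2) * D ^ d /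
      ((Nat.factorial d : ℝ) * (volume K).toReal) := by
  have hvol : 0 < (volume K).toReal :=
    ENNReal.toReal_pos (Measure.measure_pos_of_nonempty_interior _ hK.2.2).ne'
      hK.2.1.measure_ne_top
  have hD0 : 0 ≤ D := hD ▸ Metric.diam_nonneg
  have hle : (Measure.pi fun _ : Fin (d + 2) => unif K)
      {x : Fin (d + 2) → Euc d | ∃ i, x i ∈ convexHull ℝ (x '' {j | j ≠ i})} ≤
      (d + 2 : ℕ) * ((volume K)⁻¹ * ENNReal.ofReal (D ^ d / d.factorial)) := by
    simp only [Set.ofPred_exists]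
    refine (measure_iUnion_fintype_le _ _).trans ((Finset.sum_le_sum fun i _ =>
      pi_unif_mem_convexHull_le hK
        (fun y hy => hD ▸ volume_convexHull_range_le hK.2.1 f hf hy) i).trans_eq ?_)
    rw [Finset.sum_const, Finset.card_univ, Fintype.card_fin, nsmul_eq_mul]
  refine (ENNReal.toReal_mono ?_ hle).trans_eq ?_
  · exact ENNReal.mul_ne_top (ENNReal.natCast_ne_top _) (ENNReal.mul_ne_top
      (ENNReal.inv_ne_top.2 (Measure.measure_pos_of_nonempty_interior _ hK.2.2).ne')
      ENNReal.ofReal_ne_top)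
  · rw [ENNReal.toReal_mul, ENNReal.toReal_mul, ENNReal.toReal_inv,
      ENNReal.toReal_ofReal (by positivity), ENNReal.toReal_natCast]
    push_cast
    field_simp
end
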